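/- In the setting of the local lower bound theorem, the open covers can be chosen with additional entropy-approximation properties: given finite Borel partitions α_i of X_i, μ ∈ M(X_1,T_1), f ∈ C(X_1,ℝ) and ε > 0, there exist open covers U_i of X_i with |U_i|=|α_i|+1 satisfying P^a(T_1, supp μ, {U_i}_{i=1}^k, f) ≥ Σ_{i=1}^k a_i h_μ(T_1, ⋁_{j=i}^k τ_{j−1}^{−1}α_j) + ∫ f dμ − ε, and in addition |h^+_{τ_{i−1}μ}(T_i, U_i) − h_{τ_{i−1}μ}(T_i, α_i)| < ε for each 1 ≤ i ≤ k and |Σ_{i=1}^k a_i h^+_μ(T_1, ⋁_{j=i}^k τ_{j−1}^{−1}U_j) − Σ_{i=1}^k a_i h_μ(T_1, ⋁_{j=i}^k τ_{j−1}^{−1}α_j)| < ε. -/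

import Mathlib

open MeasureTheory Set Filter Topology
open scoped ENNReal symmDiff

namespace WTP

variable {k : ℕ}

/-- cumulative weight `a 1 + … + a i` (zero-indexed: `a 0 + … + a i`). -/
noncomputable def cw (a : Fin k → ℝ) (i : Fin k) : ℝ := ∑ j ∈ Finset.Iic i, a j

/-- Birkhoff sum `S_n f = ∑_{l<n} f ∘ T^l`. -/
noncomputable def birk {X : Type*} (T : X → X) (f : X → ℝ) (n : ℕ) (x : X) : ℝ :=
  ∑ l ∈ Finset.range n, f (T^[l] x)

/-- a (finite) open cover of a topological space. -/
def IsOpenCover {X : Type*} [TopologicalSpace X] (𝒰 : Set (Set X)) : Prop :=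
  𝒰.Finite ∧ (∀ U ∈ 𝒰, IsOpen U) ∧ ⋃₀ 𝒰 = Set.univ

/-- pullback of a cover along a map. -/
def pullCov {X Y : Type*} (g : X → Y) (𝒰 : Set (Set Y)) : Set (Set X) :=
  (fun U => g ⁻¹' U) '' 𝒰

/-- the quantity `exp(−s·n + (1/a₁)·sup_{x∈A} S_{⌈a₁ n⌉} f(x))`, as an element of `ℝ≥0∞`. -/
noncomputable def pterm {X : Type*} (T1 : X → X) (f : X → ℝ) (a1 s : ℝ) (n : ℕ)
    (A : Set X) : ℝ≥0∞ :=
  ENNReal.ofReal (Real.exp (-(s * n) + (1 / a1) * sSup (birk T1 f ⌈a1 * (n : ℝ)⌉₊ '' A)))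

/-- the weighted Bowen ball `B_n^𝐚(x, ε)`. -/
def wBowen {X : Fin k → Type*} [∀ i, MetricSpace (X i)] {X1 : Type*}
    (T : ∀ i, X i → X i) (τ : ∀ i, X1 → X i) (a : Fin k → ℝ)
    (n : ℕ) (x : X1) (ε : ℝ) : Set X1 :=
  {y | ∀ i : Fin k, ∀ j < ⌈cw a i * (n : ℝ)⌉₊,
      dist ((T i)^[j] (τ i x)) ((T i)^[j] (τ i y)) < ε}

section Bowen

variable [NeZero k] {X : Fin k → Type*} [∀ i, MetricSpace (X i)] {X1 : Type*}
  [MeasurableSpace X1]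

/-- `Λ^{𝐚,s}_{N,ε}(Z,f)`. -/
noncomputable def lamBowenN (T1 : X1 → X1) (T : ∀ i, X i → X i) (τ : ∀ i, X1 → X i)
    (a : Fin k → ℝ) (f : X1 → ℝ) (s ε : ℝ) (N : ℕ) (Z : Set X1) : ℝ≥0∞ :=
  ⨅ (D : Set (ℕ × Set X1)) (_ : D.Countable)
    (_ : ∀ p ∈ D, N ≤ p.1 ∧ MeasurableSet p.2 ∧ ∃ x : X1, p.2 ⊆ wBowen T τ a p.1 x ε)
    (_ : Z ⊆ ⋃ p ∈ D, p.2),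
    ∑' p : D, pterm T1 f (a 0) s p.1.1 p.1.2

/-- `Λ^{𝐚,s}_{ε}(Z,f) = lim_{N→∞} Λ^{𝐚,s}_{N,ε}(Z,f)` (an increasing limit). -/
noncomputable def lamBowen (T1 : X1 → X1) (T : ∀ i, X i → X i) (τ : ∀ i, X1 → X i)
    (a : Fin k → ℝ) (f : X1 → ℝ) (s ε : ℝ) (Z : Set X1) : ℝ≥0∞ :=
  ⨆ N : ℕ, lamBowenN T1 T τ a f s ε N Z

/-- `P^𝐚(T₁, Z, ε, f) = inf {s : Λ^{𝐚,s}_ε(Z,f) = 0}`. -/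
noncomputable def PBowenEps (T1 : X1 → X1) (T : ∀ i, X i → X i) (τ : ∀ i, X1 → X i)
    (a : Fin k → ℝ) (Z : Set X1) (f : X1 → ℝ) (ε : ℝ) : EReal :=
  sInf (Real.toEReal '' {s : ℝ | lamBowen T1 T τ a f s ε Z = 0})

/-- the 𝐚-weighted topological pressure `P^𝐚(T₁, Z, f) = lim_{ε→0} P^𝐚(T₁, Z, ε, f)`
(an increasing limit as `ε` decreases to `0`). -/
noncomputable def PBowen (T1 : X1 → X1) (T : ∀ i, X i → X i) (τ : ∀ i, X1 → X i)
    (a : Fin k → ℝ) (Z : Set X1) (f : X1 → ℝ) : EReal :=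
  ⨆ ε : {e : ℝ // 0 < e}, PBowenEps T1 T τ a Z f ε.1

/-- `W^{𝐚,s}_{N,ε}(Z,f)`. -/
noncomputable def wBowenWN (T1 : X1 → X1) (T : ∀ i, X i → X i) (τ : ∀ i, X1 → X i)
    (a : Fin k → ℝ) (f : X1 → ℝ) (s ε : ℝ) (N : ℕ) (Z : Set X1) : ℝ≥0∞ :=
  ⨅ (D : Set (ℕ × Set X1 × ℝ≥0∞)) (_ : D.Countable)
    (_ : ∀ p ∈ D, N ≤ p.1 ∧ MeasurableSet p.2.1 ∧ 0 < p.2.2 ∧ p.2.2 ≠ ⊤ ∧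
        ∃ x : X1, p.2.1 ⊆ wBowen T τ a p.1 x ε)
    (_ : ∀ z ∈ Z, 1 ≤ ∑' p : D, (p.1.2.1).indicator (fun _ => p.1.2.2) z),
    ∑' p : D, p.1.2.2 * pterm T1 f (a 0) s p.1.1 p.1.2.1

/-- `W^{𝐚,s}_{ε}(Z,f)`. -/
noncomputable def wBowenW (T1 : X1 → X1) (T : ∀ i, X i → X i) (τ : ∀ i, X1 → X i)
    (a : Fin k → ℝ) (f : X1 → ℝ) (s ε : ℝ) (Z : Set X1) : ℝ≥0∞ :=
  ⨆ N : ℕ, wBowenWN T1 T τ a f s ε N Z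

/-- `P_W^𝐚(T₁, Z, ε, f)`. -/
noncomputable def PWBowenEps (T1 : X1 → X1) (T : ∀ i, X i → X i) (τ : ∀ i, X1 → X i)
    (a : Fin k → ℝ) (Z : Set X1) (f : X1 → ℝ) (ε : ℝ) : EReal :=
  sInf (Real.toEReal '' {s : ℝ | wBowenW T1 T τ a f s ε Z = 0})

/-- the average 𝐚-weighted topological pressure `P_W^𝐚(T₁, Z, f)`. -/
noncomputable def PWBowen (T1 : X1 → X1) (T : ∀ i, X i → X i) (τ : ∀ i, X1 → X i)
    (a : Fin k → ℝ) (Z : Set X1) (f : X1 → ℝ) : EReal :=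
  ⨆ ε : {e : ℝ // 0 < e}, PWBowenEps T1 T τ a Z f ε.1

end Bowen

section Local

variable [NeZero k] {X1 : Type*} [MeasurableSpace X1]

/-- the cover `⋁_{i=1}^k (τ_{i-1}^{-1} 𝒰_i)_0^{⌈(a_1+…+a_i) n⌉ - 1}` on the first space, where
`𝒱 i` is the pulled back cover `τ_{i-1}^{-1} 𝒰_i`. -/
def jointFiber (T1 : X1 → X1) (a : Fin k → ℝ) (𝒱 : Fin k → Set (Set X1)) (n : ℕ) :
    Set (Set X1) :=
  {A | ∃ V : Fin k → ℕ → Set X1,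
      (∀ i, ∀ l < ⌈cw a i * (n : ℝ)⌉₊, V i l ∈ 𝒱 i) ∧
      A = ⋂ i : Fin k, ⋂ l ∈ Finset.range ⌈cw a i * (n : ℝ)⌉₊, (T1^[l]) ⁻¹' V i l}

/-- `Λ^{𝐚,s}_{N,{𝒰_i}}(Z,f)`. -/
noncomputable def lamLocN (T1 : X1 → X1) (a : Fin k → ℝ) (𝒱 : Fin k → Set (Set X1))
    (f : X1 → ℝ) (s : ℝ) (N : ℕ) (Z : Set X1) : ℝ≥0∞ :=
  ⨅ (D : Set (ℕ × Set X1)) (_ : D.Countable)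
    (_ : ∀ p ∈ D, N ≤ p.1 ∧ MeasurableSet p.2 ∧ ∃ A ∈ jointFiber T1 a 𝒱 p.1, p.2 ⊆ A)
    (_ : Z ⊆ ⋃ p ∈ D, p.2),
    ∑' p : D, pterm T1 f (a 0) s p.1.1 p.1.2

/-- `Λ^{𝐚,s}_{{𝒰_i}}(Z,f)`. -/
noncomputable def lamLoc (T1 : X1 → X1) (a : Fin k → ℝ) (𝒱 : Fin k → Set (Set X1))
    (f : X1 → ℝ) (s : ℝ) (Z : Set X1) : ℝ≥0∞ :=
  ⨆ N : ℕ, lamLocN T1 a 𝒱 f s N Z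

/-- the local 𝐚-weighted topological pressure `P^𝐚(T₁, Z, {𝒰_i}, f)`, expressed through the
pulled-back covers `𝒱 i = τ_{i-1}^{-1} 𝒰_i`. -/
noncomputable def PLoc (T1 : X1 → X1) (a : Fin k → ℝ) (𝒱 : Fin k → Set (Set X1))
    (Z : Set X1) (f : X1 → ℝ) : EReal :=
  sInf (Real.toEReal '' {s : ℝ | lamLoc T1 a 𝒱 f s Z = 0})

/-- `W^{𝐚,s}_{N,{𝒰_i}}(Z,f)`. -/
noncomputable def wLocN (T1 : X1 → X1) (a : Fin k → ℝ) (𝒱 : Fin k → Set (Set X1))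
    (f : X1 → ℝ) (s : ℝ) (N : ℕ) (Z : Set X1) : ℝ≥0∞ :=
  ⨅ (D : Set (ℕ × Set X1 × ℝ≥0∞)) (_ : D.Countable)
    (_ : ∀ p ∈ D, N ≤ p.1 ∧ MeasurableSet p.2.1 ∧ 0 < p.2.2 ∧ p.2.2 ≠ ⊤ ∧
        ∃ A ∈ jointFiber T1 a 𝒱 p.1, p.2.1 ⊆ A)
    (_ : ∀ z ∈ Z, 1 ≤ ∑' p : D, (p.1.2.1).indicator (fun _ => p.1.2.2) z),
    ∑' p : D, p.1.2.2 * pterm T1 f (a 0) s p.1.1 p.1.2.1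

/-- `W^{𝐚,s}_{{𝒰_i}}(Z,f)`. -/
noncomputable def wLoc (T1 : X1 → X1) (a : Fin k → ℝ) (𝒱 : Fin k → Set (Set X1))
    (f : X1 → ℝ) (s : ℝ) (Z : Set X1) : ℝ≥0∞ :=
  ⨆ N : ℕ, wLocN T1 a 𝒱 f s N Z

/-- the local average 𝐚-weighted topological pressure `P_W^𝐚(T₁, Z, {𝒰_i}, f)`. -/
noncomputable def PWLoc (T1 : X1 → X1) (a : Fin k → ℝ) (𝒱 : Fin k → Set (Set X1))
    (Z : Set X1) (f : X1 → ℝ) : EReal :=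
  sInf (Real.toEReal '' {s : ℝ | wLoc T1 a 𝒱 f s Z = 0})

end Local

/-- iterated join `(𝒰)_0^{n-1} = ⋁_{l=0}^{n-1} T^{-l} 𝒰` of a cover. -/
def covJoinT {X : Type*} (T : X → X) (𝒰 : Set (Set X)) (n : ℕ) : Set (Set X) :=
  {A | ∃ u : ℕ → Set X, (∀ l < n, u l ∈ 𝒰) ∧
      A = ⋂ l ∈ Finset.range n, (T^[l]) ⁻¹' u l}

/-- the join `⋁_{j=i}^{k} 𝒱 j` of covers of a single space (in applications
`𝒱 j = τ_{j-1}^{-1} 𝒰_j`). -/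
def joinFrom {X1 : Type*} (𝒱 : Fin k → Set (Set X1)) (i : Fin k) : Set (Set X1) :=
  {A | ∃ V : Fin k → Set X1, (∀ j, i ≤ j → V j ∈ 𝒱 j) ∧ A = ⋂ j ∈ Finset.Ici i, V j}

/-- a finite measurable partition (indexed). -/
def IsPart {X : Type*} [MeasurableSpace X] {ι : Type*} (β : ι → Set X) : Prop :=
  (∀ i, MeasurableSet (β i)) ∧ (∀ i j, i ≠ j → Disjoint (β i) (β j)) ∧ ⋃ i, β i = Set.univ

/-- the static entropy `H_μ(β) = -∑ μ(B) log μ(B)` of a finite (indexed) partition. -/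
noncomputable def entH {X : Type*} [MeasurableSpace X] {ι : Type*} [Fintype ι]
    (μ : Measure X) (β : ι → Set X) : ℝ :=
  ∑ i, Real.negMulLog (μ (β i)).toReal

/-- the dynamical join `⋁_{l=0}^{n-1} T^{-l} β` of a partition. -/
def dynJoin {X : Type*} (T : X → X) {ι : Type*} (β : ι → Set X) (n : ℕ) :
    (Fin n → ι) → Set X :=
  fun c => ⋂ l : Fin n, (T^[(l : ℕ)]) ⁻¹' β (c l)

/-- the measure-theoretic entropy `h_μ(T, β) = lim_n (1/n) H_μ(⋁_{l<n} T^{-l}β)` of `T`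
relative to a finite partition. -/
noncomputable def hPart {X : Type*} [MeasurableSpace X] {ι : Type*} [Fintype ι]
    (μ : Measure X) (T : X → X) (β : ι → Set X) : EReal :=
  Filter.liminf (fun n : ℕ => ((entH μ (dynJoin T β n) / n : ℝ) : EReal)) Filter.atTop

/-- the Kolmogorov–Sinai entropy `h_μ(T)`. -/
noncomputable def hKS {X : Type*} [MeasurableSpace X] (μ : Measure X) (T : X → X) : EReal :=
  ⨆ p : (Σ m : ℕ, {β : Fin m → Set X // IsPart β}), hPart μ T p.2.1

/-- `H_μ(𝒰) = inf {H_μ(β) : β a finite measurable partition refining 𝒰}`. -/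
noncomputable def covH {X : Type*} [MeasurableSpace X] (μ : Measure X)
    (𝒰 : Set (Set X)) : ℝ :=
  sInf {h : ℝ | ∃ (m : ℕ) (β : Fin m → Set X), IsPart β ∧
      (∀ i, ∃ U ∈ 𝒰, β i ⊆ U) ∧ h = entH μ β}

/-- the local measure-theoretic entropy `h_μ(T, 𝒰) = lim_n (1/n) H_μ((𝒰)_0^{n-1})` of `T`
relative to an open cover. -/
noncomputable def hCov {X : Type*} [MeasurableSpace X] (μ : Measure X) (T : X → X)
    (𝒰 : Set (Set X)) : EReal :=
  Filter.liminf (fun n : ℕ => ((covH μ (covJoinT T 𝒰 n) / n : ℝ) : EReal)) Filter.atTop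

/-- `h⁺_μ(T,𝒰) = inf {h_μ(T,β) : β a finite measurable partition refining 𝒰}`. -/
noncomputable def hCovPlus {X : Type*} [MeasurableSpace X] (μ : Measure X) (T : X → X)
    (𝒰 : Set (Set X)) : EReal :=
  ⨅ p : (Σ m : ℕ, {β : Fin m → Set X // IsPart β ∧ ∀ i, ∃ U ∈ 𝒰, β i ⊆ U}),
    hPart μ T p.2.1

/-- the join `⋁_{j=i}^{k} γ j` of partitions of a single space (in applications
`γ j = τ_{j-1}^{-1} α_j`). -/
def partJoinFrom {X1 : Type*} {ι : Fin k → Type*} (γ : ∀ j, ι j → Set X1) (i : Fin k) :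
    (∀ j : {j : Fin k // i ≤ j}, ι j) → Set X1 :=
  fun c => ⋂ j : {j : Fin k // i ≤ j}, γ j (c j)

/-- the partition `⋁_{i=1}^k (γ_i)_0^{⌈(a_1+…+a_i)N⌉-1}` on the first space, where
`γ i = τ_{i-1}^{-1} α_i`. -/
def bigPartJoin {X1 : Type*} (T1 : X1 → X1) (a : Fin k → ℝ) {ι : Fin k → Type*}
    (γ : ∀ i, ι i → Set X1) (N : ℕ) :
    (∀ i : Fin k, Fin ⌈cw a i * (N : ℝ)⌉₊ → ι i) → Set X1 :=
  fun c => ⋂ i : Fin k, ⋂ l : Fin ⌈cw a i * (N : ℝ)⌉₊, (T1^[(l : ℕ)]) ⁻¹' γ i (c i l)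

/-- conditional entropy `H_μ(γ|β) = H_μ(γ ∨ β) - H_μ(β)`. -/
noncomputable def condEnt {X : Type*} [MeasurableSpace X] {ι κ : Type*} [Fintype ι] [Fintype κ]
    (μ : Measure X) (γ : ι → Set X) (β : κ → Set X) : ℝ :=
  entH μ (fun p : ι × κ => γ p.1 ∩ β p.2) - entH μ β

/-- the oscillation `w_f(⋁_{i=1}^k τ_{i-1}^{-1} 𝒰_i)` of `f` on the joined cover, where
`𝒱 i = τ_{i-1}^{-1} 𝒰_i`. -/
noncomputable def wfJoin {X1 : Type*} (f : X1 → ℝ) (𝒱 : Fin k → Set (Set X1)) : ℝ :=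
  sSup {d : ℝ | ∃ V : Fin k → Set X1, (∀ i, V i ∈ 𝒱 i) ∧
      ∃ x ∈ ⋂ i, V i, ∃ y ∈ ⋂ i, V i, d = |f x - f y|}

/-- the topological support of a measure. -/
def msupp {X : Type*} [TopologicalSpace X] [MeasurableSpace X] (μ : Measure X) : Set X :=
  {x | ∀ U : Set X, IsOpen U → x ∈ U → 0 < μ U}

section Birkhoff

variable {X : Type*}

lemma birk_zero (T : X → X) (f : X → ℝ) (x : X) : birk T f 0 x = 0 := by simp [birk]

lemma birk_succ (T : X → X) (f : X → ℝ) (n : ℕ) (x : X) :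
    birk T f (n + 1) x = f x + birk T f n (T x) := by
  simp only [birk, Finset.sum_range_succ', Function.iterate_succ, Function.comp_apply,
    Function.iterate_zero, id]
  ring

lemma abs_birk_le {T : X → X} {f : X → ℝ} {C : ℝ} (hC : ∀ x, |f x| ≤ C) (n : ℕ) (x : X) :
    |birk T f n x| ≤ n * C := by
  calc |birk T f n x| ≤ ∑ l ∈ Finset.range n, |f (T^[l] x)| := Finset.abs_sum_le_sum_abs _ _
    _ ≤ ∑ l ∈ Finset.range n, C := Finset.sum_le_sum fun l _ => hC _
    _ = n * C := by simp

lemma birk_div_mem {T : X → X} {f : X → ℝ} {C : ℝ} (hC : ∀ x, |f x| ≤ C) (n : ℕ) (x : X) :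
    |birk T f n x / n| ≤ C := by
  have hC0 : 0 ≤ C := (abs_nonneg _).trans (hC x)
  rw [abs_div, Nat.abs_cast]
  exact div_le_of_le_mul₀ (by positivity) hC0 (by rw [mul_comm]; exact abs_birk_le hC n x)

lemma birk_neg (T : X → X) (f : X → ℝ) (n : ℕ) (x : X) :
    birk T (fun y => - f y) n x = - birk T f n x := by
  simp [birk]

/-- the running maximum `max_{j ≤ n} S_j g`, defined recursively. -/
noncomputable def birkMax (T : X → X) (g : X → ℝ) : ℕ → X → ℝ
  | 0 => fun _ => 0
  | n + 1 => fun x => max 0 (g x + birkMax T g n (T x))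

lemma birkMax_nonneg (T : X → X) (g : X → ℝ) (n : ℕ) (x : X) : 0 ≤ birkMax T g n x := by
  cases n <;> simp [birkMax]

lemma birkMax_le_succ (T : X → X) (g : X → ℝ) (n : ℕ) (x : X) :
    birkMax T g n x ≤ birkMax T g (n + 1) x := by
  induction n generalizing x with
  | zero => simp [birkMax]
  | succ n ih =>
    change max 0 (g x + birkMax T g n (T x)) ≤ max 0 (g x + birkMax T g (n + 1) (T x))
    gcongr
    exact ih _

lemma birk_le_birkMax (T : X → X) (g : X → ℝ) (n : ℕ) (x : X) :
    birk T g n x ≤ birkMax T g n x := by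
  induction n generalizing x with
  | zero => simp [birkMax, birk_zero]
  | succ n ih =>
    rw [birk_succ]
    exact le_max_of_le_right (by gcongr; exact ih _)

lemma birkMax_le {T : X → X} {g : X → ℝ} {C : ℝ} (hC : ∀ x, |g x| ≤ C) (n : ℕ) (x : X) :
    birkMax T g n x ≤ n * C := by
  have hC0 : 0 ≤ C := (abs_nonneg _).trans (hC x)
  induction n generalizing x with
  | zero => simp [birkMax]
  | succ n ih =>
    refine max_le (by positivity) ?_
    have := ih (T x)
    have := (abs_le.1 (hC x)).2
    push_cast
    linarith

variable [MeasurableSpace X] {μ : Measure X}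

lemma measurable_birk {T : X → X} (hT : Measurable T) {f : X → ℝ} (hf : Measurable f) (n : ℕ) :
    Measurable (birk T f n) := by
  unfold birk
  exact Finset.measurable_sum _ fun l _ => hf.comp (hT.iterate l)

lemma measurable_birkMax {T : X → X} (hT : Measurable T) {g : X → ℝ} (hg : Measurable g) (n : ℕ) :
    Measurable (birkMax T g n) := by
  induction n with
  | zero => exact measurable_const
  | succ n ih => exact measurable_const.max (hg.add (ih.comp hT))

lemma integrable_of_abs_le [IsFiniteMeasure μ] {f : X → ℝ} (hf : Measurable f) {C : ℝ}
    (hC : ∀ x, |f x| ≤ C) : Integrable f μ :=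
  Integrable.of_bound hf.aestronglyMeasurable C (Eventually.of_forall hC)

/-- Garsia's maximal ergodic inequality. -/
lemma setIntegral_birkMax_nonneg [IsFiniteMeasure μ] {T : X → X} (hT : MeasurePreserving T μ μ)
    {g : X → ℝ} (hg : Measurable g) {C : ℝ} (hC : ∀ x, |g x| ≤ C) (n : ℕ) :
    0 ≤ ∫ x in {x | 0 < birkMax T g n x}, g x ∂μ := by
  have hms : MeasurableSet {x | 0 < birkMax T g n x} :=
    measurableSet_lt measurable_const (measurable_birkMax hT.measurable hg n)
  have hMm := measurable_birkMax hT.measurable hg n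
  have hMi : Integrable (birkMax T g n) μ := integrable_of_abs_le hMm (C := n * C) fun x => by
    rw [abs_of_nonneg (birkMax_nonneg T g n x)]; exact birkMax_le hC n x
  have hMTi : Integrable (fun x => birkMax T g n (T x)) μ := hT.integrable_comp_of_integrable hMi
  have hle : ∀ x, birkMax T g n x ≤
      {x | 0 < birkMax T g n x}.indicator g x + birkMax T g n (T x) := by
    intro x
    by_cases hx : 0 < birkMax T g n x
    · rw [indicator_of_mem (show x ∈ {x | 0 < birkMax T g n x} from hx)]
      cases n with
      | zero => simp [birkMax] at hx
      | succ n =>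
        have h1 : birkMax T g (n + 1) x = max 0 (g x + birkMax T g n (T x)) := rfl
        have h2 := birkMax_le_succ T g n (T x)
        rw [h1] at hx ⊢
        rcases lt_max_iff.1 hx with h | h
        · exact absurd h (lt_irrefl _)
        · rw [max_eq_right h.le]; linarith
    · rw [indicator_of_notMem (show x ∉ {x | 0 < birkMax T g n x} from hx), zero_add]
      exact (not_lt.1 hx).trans (birkMax_nonneg _ _ _ _)
  have hgi : Integrable ({x | 0 < birkMax T g n x}.indicator g) μ :=
    (integrable_of_abs_le hg hC).indicator hms
  have h1 := integral_mono hMi (hgi.add hMTi) hle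
  have h2 : ∫ x, birkMax T g n (T x) ∂μ = ∫ x, birkMax T g n x ∂μ := by
    conv_rhs => rw [← hT.map_eq]
    rw [integral_map hT.aemeasurable hMm.aestronglyMeasurable]
  simp only [Pi.add_apply] at h1
  rw [integral_add hgi hMTi, h2, integral_indicator hms] at h1
  linarith

lemma limsup_eq_of_tendsto_sub {u v : ℕ → ℝ} {C : ℝ} (hu : ∀ n, |u n| ≤ C) (hv : ∀ n, |v n| ≤ C)
    (h : Tendsto (fun n => u n - v n) atTop (𝓝 0)) : limsup u atTop = limsup v atTop := by
  have key : ∀ u v : ℕ → ℝ, (∀ n, |u n| ≤ C) → (∀ n, |v n| ≤ C) →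
      Tendsto (fun n => u n - v n) atTop (𝓝 0) → limsup u atTop ≤ limsup v atTop := by
    intro u v hu hv h
    refine le_of_forall_pos_le_add fun ε hε => ?_
    have hbv : IsBoundedUnder (· ≤ ·) atTop v :=
      isBoundedUnder_of ⟨C, fun n => (abs_le.1 (hv n)).2⟩
    have hcu : IsCoboundedUnder (· ≤ ·) atTop u :=
      (isBoundedUnder_of ⟨-C, fun n => (abs_le.1 (hu n)).1⟩ :
        IsBoundedUnder (· ≥ ·) atTop u).isCoboundedUnder_le
    have h1 : ∀ᶠ n in atTop, v n < limsup v atTop + ε / 2 :=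
      eventually_lt_of_limsup_lt (by linarith) hbv
    have h2 : ∀ᶠ n in atTop, u n - v n < ε / 2 := h.eventually_lt_const (by linarith)
    exact limsup_le_of_le hcu (by filter_upwards [h1, h2] with n h1 h2; linarith)
  refine le_antisymm (key u v hu hv h) (key v u hv hu ?_)
  simpa using h.neg

/-- the upper Birkhoff average. -/
noncomputable def upBirk (T : X → X) (f : X → ℝ) (x : X) : ℝ :=
  limsup (fun n : ℕ => birk T f n x / n) atTop

omit [MeasurableSpace X] in
lemma upBirk_comp {T : X → X} {f : X → ℝ} {C : ℝ} (hC : ∀ x, |f x| ≤ C) (x : X) :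
    upBirk T f (T x) = upBirk T f x := by
  unfold upBirk
  rw [← limsup_nat_add (fun n : ℕ => birk T f n x / n) 1]
  refine limsup_eq_of_tendsto_sub (C := C) (fun n => birk_div_mem hC _ _)
    (fun n => birk_div_mem hC _ _) ?_
  have hC0 : 0 ≤ C := (abs_nonneg _).trans (hC x)
  refine squeeze_zero_norm' (a := fun n : ℕ => (2 * C) * (1 / ((n : ℝ) + 1))) ?_ ?_
  · filter_upwards [eventually_gt_atTop 0] with n hn
    have hn' : (0 : ℝ) < n := by exact_mod_cast hn
    rw [birk_succ]
    have e : birk T f n (T x) / n - (f x + birk T f n (T x)) / ((n + 1 : ℕ) : ℝ)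
        = (birk T f n (T x) / n - f x) * (1 / ((n : ℝ) + 1)) := by
      push_cast
      field_simp
      ring
    rw [e, norm_mul, Real.norm_eq_abs, Real.norm_eq_abs,
      abs_of_pos (by positivity : 0 < 1 / ((n : ℝ) + 1))]
    gcongr
    calc |birk T f n (T x) / n - f x| ≤ |birk T f n (T x) / n| + |f x| := abs_sub _ _
      _ ≤ 2 * C := by linarith [birk_div_mem hC n (T x) (T := T), hC x]
  · simpa using (tendsto_one_div_add_atTop_nhds_zero_nat (𝕜 := ℝ)).const_mul (2 * C)

omit [MeasurableSpace X] in
lemma upBirk_abs_le {T : X → X} {f : X → ℝ} {C : ℝ} (hC : ∀ x, |f x| ≤ C) (x : X) :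
    |upBirk T f x| ≤ C := by
  have hb := fun n => abs_le.1 (birk_div_mem (T := T) hC n x)
  have hbu : IsBoundedUnder (· ≤ ·) atTop (fun n : ℕ => birk T f n x / n) :=
    isBoundedUnder_of ⟨C, fun n => (hb n).2⟩
  have hcu : IsCoboundedUnder (· ≤ ·) atTop (fun n : ℕ => birk T f n x / n) :=
    (isBoundedUnder_of ⟨-C, fun n => (hb n).1⟩ :
      IsBoundedUnder (· ≥ ·) atTop _).isCoboundedUnder_le
  exact abs_le.2 ⟨le_limsup_of_frequently_le (Frequently.of_forall fun n => (hb n).1) hbu,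
    limsup_le_of_le hcu (Eventually.of_forall fun n => (hb n).2)⟩

lemma measurable_upBirk {T : X → X} (hT : Measurable T) {f : X → ℝ} (hf : Measurable f) :
    Measurable (upBirk T f) :=
  Measurable.limsup fun n => (measurable_birk hT hf n).div_const _

lemma integral_upBirk_le [IsProbabilityMeasure μ] {T : X → X} (hT : MeasurePreserving T μ μ)
    {f : X → ℝ} (hf : Measurable f) {C : ℝ} (hC : ∀ x, |f x| ≤ C) :
    ∫ x, upBirk T f x ∂μ ≤ ∫ x, f x ∂μ := by
  refine le_of_forall_pos_le_add fun ε hε => ?_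
  have hum := measurable_upBirk hT.measurable hf
  set g : X → ℝ := fun x => f x - (upBirk T f x - ε) with hg
  have hgm : Measurable g := hf.sub (hum.sub_const _)
  have hgC : ∀ x, |g x| ≤ 2 * C + ε := fun x => by
    have h1 := abs_le.1 (hC x)
    have h2 := abs_le.1 (upBirk_abs_le (T := T) hC x)
    exact abs_le.2 ⟨by simp only [hg]; linarith, by simp only [hg]; linarith⟩
  have hbg : ∀ (n : ℕ) x, birk T g n x = birk T f n x - n * (upBirk T f x - ε) := by
    intro n
    induction n with
    | zero => intro x; simp [birk_zero]
    | succ n ih =>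
      intro x
      rw [birk_succ, birk_succ, ih, upBirk_comp hC]
      simp only [hg]; push_cast; ring
  have hpos : ⋃ n, {x | 0 < birkMax T g n x} = univ := by
    refine eq_univ_of_forall fun x => mem_iUnion.2 ?_
    have hcu : IsCoboundedUnder (· ≤ ·) atTop (fun n : ℕ => birk T f n x / n) :=
      (isBoundedUnder_of ⟨-C, fun n => (abs_le.1 (birk_div_mem (T := T) hC n x)).1⟩ :
        IsBoundedUnder (· ≥ ·) atTop _).isCoboundedUnder_le
    have hfr : ∃ᶠ n : ℕ in atTop, upBirk T f x - ε < birk T f n x / n :=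
      frequently_lt_of_lt_limsup hcu (by change _ < upBirk T f x; linarith)
    obtain ⟨n, hn, hn0⟩ := (hfr.and_eventually (eventually_gt_atTop 0)).exists
    refine ⟨n, lt_of_lt_of_le ?_ (birk_le_birkMax T g n x)⟩
    have hn' : (0 : ℝ) < n := by exact_mod_cast hn0
    rw [hbg]
    rw [lt_div_iff₀ hn'] at hn
    linarith
  have hlim := tendsto_setIntegral_of_monotone (μ := μ) (f := g)
    (s := fun n => {x | 0 < birkMax T g n x})
    (fun n => measurableSet_lt measurable_const (measurable_birkMax hT.measurable hgm n))
    (monotone_nat_of_le_succ fun n x hx => lt_of_lt_of_le hx (birkMax_le_succ T g n x))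
    (integrable_of_abs_le hgm hgC).integrableOn
  rw [hpos, setIntegral_univ] at hlim
  have h0 := ge_of_tendsto' hlim fun n => setIntegral_birkMax_nonneg hT hgm hgC n
  have hui := integrable_of_abs_le (μ := μ) hum (upBirk_abs_le (T := T) hC)
  have : ∫ x, g x ∂μ = ∫ x, f x ∂μ - (∫ x, upBirk T f x ∂μ - ε) := by
    simp only [hg]
    rw [integral_sub (integrable_of_abs_le hf hC) (g := fun x => upBirk T f x - ε)
      (hui.sub (integrable_const _)), integral_sub hui (integrable_const _)]
    simp
  linarith

/-- Birkhoff's pointwise ergodic theorem for bounded functions. -/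
theorem birkhoff_bounded [IsProbabilityMeasure μ] {T : X → X} (hT : MeasurePreserving T μ μ)
    {f : X → ℝ} (hf : Measurable f) {C : ℝ} (hC : ∀ x, |f x| ≤ C) :
    ∃ g : X → ℝ, Measurable g ∧ (∀ x, |g x| ≤ C) ∧ ∫ x, g x ∂μ = ∫ x, f x ∂μ ∧
      ∀ᵐ x ∂μ, Tendsto (fun n : ℕ => birk T f n x / n) atTop (𝓝 (g x)) := by
  have hC' : ∀ x, |(-f x)| ≤ C := fun x => by rw [abs_neg]; exact hC x
  have hu := measurable_upBirk hT.measurable hf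
  have hl := measurable_upBirk hT.measurable hf.neg
  have hui := integrable_of_abs_le (μ := μ) hu (upBirk_abs_le (T := T) hC)
  have hli := integrable_of_abs_le (μ := μ) hl (upBirk_abs_le (T := T) hC')
  have h1 := integral_upBirk_le hT hf hC
  have h2 := integral_upBirk_le hT hf.neg hC'
  have hev : ∀ x, ∀ ε > 0, ∀ᶠ n : ℕ in atTop, birk T f n x / n < upBirk T f x + ε ∧
      -(birk T f n x / n) < upBirk T (-f) x + ε := by
    intro x ε hε
    have key : ∀ f : X → ℝ, (∀ x, |f x| ≤ C) →
        ∀ᶠ n : ℕ in atTop, birk T f n x / n < upBirk T f x + ε := fun f hC =>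
      eventually_lt_of_limsup_lt (by change upBirk T f x < _; linarith)
        (isBoundedUnder_of ⟨C, fun n => (abs_le.1 (birk_div_mem (T := T) hC n x)).2⟩)
    filter_upwards [key f hC, key (-f) hC'] with n h3 h4
    refine ⟨h3, ?_⟩
    rwa [show birk T (-f) n x = - birk T f n x from birk_neg T f n x, neg_div] at h4
  have hnn : ∀ x, 0 ≤ upBirk T f x + upBirk T (-f) x := by
    intro x
    refine le_of_forall_pos_le_add fun ε hε => ?_
    obtain ⟨n, h3, h4⟩ := (hev x (ε / 2) (by linarith)).exists
    linarith
  have hneg : ∫ x, (-f) x ∂μ = - ∫ x, f x ∂μ := integral_neg f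
  have hadd := integral_add hui hli
  have hnonneg := integral_nonneg (μ := μ) (f := fun x => upBirk T f x + upBirk T (-f) x) hnn
  have hzero : (fun x => upBirk T f x + upBirk T (-f) x) =ᵐ[μ] 0 :=
    (integral_eq_zero_iff_of_nonneg hnn (hui.add hli)).1 (by linarith)
  refine ⟨upBirk T f, hu, upBirk_abs_le hC, by linarith, ?_⟩
  filter_upwards [hzero] with x hx
  simp only [Pi.zero_apply] at hx
  rw [Metric.tendsto_nhds]
  intro ε hε
  filter_upwards [hev x ε hε] with n hn
  rw [Real.dist_eq, abs_lt]
  constructor <;> linarith [hn.1, hn.2]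

end Birkhoff

section Gibbs

variable {A B : Type*} [Fintype A] [Fintype B]

lemma sum_negMulLog_le_add (S : A → B → ℝ) (hS : ∀ a b, 0 ≤ S a b) (hS1 : ∑ a, ∑ b, S a b = 1)
    (q : B → A → ℝ) (hq : ∀ b a, 0 < q b a) (hq1 : ∀ b, ∑ a, q b a ≤ 1) :
    ∑ a, Real.negMulLog (∑ b, S a b) ≤
      ∑ b, Real.negMulLog (∑ a, S a b) + ∑ a, ∑ b, S a b * (-Real.log (q b a)) := by
  have e1 : ∑ a, Real.negMulLog (∑ b, S a b)
      = ∑ a, ∑ b, S a b * (-Real.log (∑ b', S a b')) := by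
    refine Finset.sum_congr rfl fun a _ => ?_
    rw [← Finset.sum_mul, Real.negMulLog]; ring
  have e2 : ∑ b, Real.negMulLog (∑ a, S a b)
      = ∑ a, ∑ b, S a b * (-Real.log (∑ a', S a' b)) := by
    rw [Finset.sum_comm]
    refine Finset.sum_congr rfl fun b _ => ?_
    rw [← Finset.sum_mul, Real.negMulLog]; ring
  have e3 : ∑ a, ∑ b, S a b * (-Real.log (∑ b', S a b'))
      ≤ ∑ a, ∑ b, (S a b * (-Real.log (∑ a', S a' b)) + S a b * (-Real.log (q b a))
        + ((∑ a', S a' b) * q b a - S a b)) := by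
    refine Finset.sum_le_sum fun a _ => Finset.sum_le_sum fun b _ => ?_
    have hr0 : 0 ≤ ∑ a', S a' b := Finset.sum_nonneg fun a' _ => hS a' b
    rcases (hS a b).eq_or_lt with h | h
    · rw [← h]; simp only [zero_mul, zero_add, sub_zero]
      exact mul_nonneg hr0 (hq b a).le
    · have hp : S a b ≤ ∑ b', S a b' :=
        Finset.single_le_sum (f := fun b' => S a b') (fun b' _ => hS a b') (Finset.mem_univ b)
      have hr : S a b ≤ ∑ a', S a' b :=
        Finset.single_le_sum (f := fun a' => S a' b) (fun a' _ => hS a' b) (Finset.mem_univ a)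
      set p := ∑ b', S a b'
      set r := ∑ a', S a' b
      have hp0 : 0 < p := h.trans_le hp
      have hr0 : 0 < r := h.trans_le hr
      have hlog := Real.log_le_sub_one_of_pos (show 0 < r * q b a / p by
        have := hq b a; positivity)
      rw [Real.log_div (mul_pos hr0 (hq b a)).ne' hp0.ne',
        Real.log_mul hr0.ne' (hq b a).ne'] at hlog
      have h2 : S a b * (r * q b a / p) ≤ r * q b a := by
        rw [mul_div_assoc', div_le_iff₀ hp0, mul_comm]
        gcongr
        exact mul_nonneg hr0.le (hq b a).le
      nlinarith [mul_le_mul_of_nonneg_left hlog h.le]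
  have e4 : ∑ a, ∑ b, ((∑ a', S a' b) * q b a - S a b) ≤ 0 := by
    simp only [Finset.sum_sub_distrib]
    rw [hS1, Finset.sum_comm]
    have : ∀ b, ∑ a, (∑ a', S a' b) * q b a ≤ ∑ a', S a' b := fun b => by
      rw [← Finset.mul_sum]
      exact mul_le_of_le_one_right (Finset.sum_nonneg fun a' _ => hS a' b) (hq1 b)
    have h5 := Finset.sum_le_sum fun b (_ : b ∈ Finset.univ) => this b
    rw [Finset.sum_comm (f := fun b a' => S a' b), hS1] at h5
    linarith
  rw [e1, e2]
  simp only [Finset.sum_add_distrib] at e3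
  linarith

end Gibbs

section Symbols

variable {X : Type*} {A B : Type*}

/-- the partition into the fibers of a symbol map. -/
def fib (ξ : X → A) : A → Set X := fun i => Set.preimage ξ {i}

/-- the word of length `n` read along the orbit. -/
def word (T : X → X) (ξ : X → A) (n : ℕ) (x : X) : Fin n → A := fun l => ξ (T^[(l : ℕ)] x)

lemma dynJoin_fib (T : X → X) (ξ : X → A) (n : ℕ) :
    dynJoin T (fib ξ) n = fib (word T ξ n) := by
  funext c
  ext x
  simp [dynJoin, fib, word, funext_iff]

variable [MeasurableSpace X] [MeasurableSpace A] [MeasurableSpace B]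

lemma measurable_word {T : X → X} (hT : Measurable T) {ξ : X → A} (hξ : Measurable ξ) (n : ℕ) :
    Measurable (word T ξ n) :=
  measurable_pi_lambda _ fun l => hξ.comp (hT.iterate l)

lemma IsPart.exists_fib {ι : Type*} [Countable ι] [MeasurableSpace ι] [MeasurableSingletonClass ι]
    {β : ι → Set X} (hβ : IsPart β) :
    ∃ ξ : X → ι, Measurable ξ ∧ β = fib ξ := by
  have h : ∀ x, ∃ i, x ∈ β i := fun x => by
    have : x ∈ ⋃ i, β i := hβ.2.2 ▸ mem_univ x
    exact mem_iUnion.1 this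
  choose ξ hξ using h
  have e : β = fib ξ := by
    funext i
    ext x
    refine ⟨fun hx => ?_, fun hx => ?_⟩
    · by_contra hne
      exact disjoint_left.1 (hβ.2.1 (ξ x) i (fun h => hne h)) (hξ x) hx
    · have : ξ x = i := hx
      exact this ▸ hξ x
  refine ⟨ξ, measurable_to_countable' fun i => ?_, e⟩
  have := hβ.1 i
  rwa [e] at this

lemma isPart_fib [MeasurableSingletonClass A] {ξ : X → A} (hξ : Measurable ξ) : IsPart (fib ξ) := by
  refine ⟨fun i => hξ (measurableSet_singleton i), fun i j hij => ?_, ?_⟩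
  · exact disjoint_left.2 fun x hx hx' => hij ((show ξ x = i from hx).symm.trans hx')
  · exact eq_univ_of_forall fun x => mem_iUnion.2 ⟨ξ x, rfl⟩

variable [Fintype A] [Fintype B] [MeasurableSingletonClass A] [MeasurableSingletonClass B]
  {μ : Measure X}

lemma integral_comp_fintype [IsFiniteMeasure μ] {ξ : X → A} (hξ : Measurable ξ) (φ : A → ℝ) :
    ∫ x, φ (ξ x) ∂μ = ∑ a, μ.real (ξ ⁻¹' {a}) * φ a := by
  rw [← integral_map (f := φ) hξ.aemeasurable (measurable_of_finite φ).aestronglyMeasurable,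
    integral_fintype Integrable.of_finite]
  refine Finset.sum_congr rfl fun a _ => ?_
  rw [map_measureReal_apply hξ (measurableSet_singleton a), smul_eq_mul]

lemma entH_le_add_integral [IsProbabilityMeasure μ] {ξ : X → A} (hξ : Measurable ξ)
    {ζ : X → B} (hζ : Measurable ζ)
    (q : B → A → ℝ) (hq : ∀ b a, 0 < q b a) (hq1 : ∀ b, ∑ a, q b a ≤ 1) :
    entH μ (fib ξ) ≤ entH μ (fib ζ) + ∫ x, -Real.log (q (ζ x) (ξ x)) ∂μ := by
  have hm : Measurable fun x => (ξ x, ζ x) := hξ.prodMk hζ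
  set S : A → B → ℝ := fun a b => μ.real ((fun x => (ξ x, ζ x)) ⁻¹' {(a, b)}) with hSdef
  have hfin := integral_comp_fintype (μ := μ) hm (fun p : A × B => -Real.log (q p.2 p.1))
  rw [Fintype.sum_prod_type] at hfin
  have hp : ∀ a, ∑ b, S a b = μ.real (ξ ⁻¹' {a}) := fun a => by
    have h1 := integral_comp_fintype (μ := μ) hm (fun p : A × B => ({a} : Set A).indicator 1 p.1)
    have h2 := integral_comp_fintype (μ := μ) hξ (fun p : A => ({a} : Set A).indicator 1 p)
    rw [Fintype.sum_prod_type] at h1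
    rw [h1] at h2
    classical
    simpa [Set.indicator_apply, Finset.sum_ite_eq', ← Finset.sum_mul] using h2
  have hr : ∀ b, ∑ a, S a b = μ.real (ζ ⁻¹' {b}) := fun b => by
    have h1 := integral_comp_fintype (μ := μ) hm (fun p : A × B => ({b} : Set B).indicator 1 p.2)
    have h2 := integral_comp_fintype (μ := μ) hζ (fun p : B => ({b} : Set B).indicator 1 p)
    rw [Fintype.sum_prod_type] at h1
    rw [h1] at h2
    classical
    simpa [Set.indicator_apply, Finset.sum_ite_eq', ← Finset.sum_mul] using h2
  have hone : ∑ a, ∑ b, S a b = 1 := by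
    have h1 := integral_comp_fintype (μ := μ) hm (fun _ : A × B => 1)
    rw [Fintype.sum_prod_type] at h1
    simpa using h1.symm
  have := sum_negMulLog_le_add S (fun a b => measureReal_nonneg) hone q hq hq1
  simp only [hp, hr] at this
  rw [hfin]
  exact this

lemma entH_word_le_add [IsProbabilityMeasure μ] {T : X → X} (hT : MeasurePreserving T μ μ)
    {ξ : X → A} (hξ : Measurable ξ) {ζ : X → B} (hζ : Measurable ζ)
    (φ : B → A) {D : Set X} (hD : MeasurableSet D) (hφ : ∀ x, x ∉ D → ξ x = φ (ζ x))
    {t : ℝ} (ht : 0 < t) (ht1 : t ≤ 1) (n : ℕ) :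
    entH μ (fib (word T ξ n)) ≤ entH μ (fib (word T ζ n)) +
      n * (Real.log (1 + Fintype.card A * t) + μ.real D * Real.log (1 / t)) := by
  classical
  set c : ℝ := 1 + Fintype.card A * t with hc
  have hc0 : 0 < c := by positivity
  set q : B → A → ℝ := fun b a => (if a = φ b then 1 else t) / c with hqdef
  have hq : ∀ b a, 0 < q b a := fun b a => by
    simp only [hqdef]; split_ifs <;> positivity
  have hq1 : ∀ b, ∑ a, q b a ≤ 1 := fun b => by
    simp only [hqdef]
    rw [← Finset.sum_div, div_le_one hc0]
    calc ∑ a, (if a = φ b then (1 : ℝ) else t) ≤ ∑ a, ((if a = φ b then (1 : ℝ) else 0) + t) :=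
          Finset.sum_le_sum fun a _ => by split_ifs <;> linarith
      _ = c := by simp [Finset.sum_add_distrib, hc]
  have hlt : 0 ≤ Real.log (1 / t) := Real.log_nonneg (by rw [le_div_iff₀ ht]; linarith)
  set G : X → ℝ := fun x => Real.log c + D.indicator (fun _ => Real.log (1 / t)) x with hG
  have hqG : ∀ x, -Real.log (q (ζ x) (ξ x)) ≤ G x := fun x => by
    simp only [hqdef, hG]
    by_cases hx : x ∈ D
    · rw [indicator_of_mem hx]
      split_ifs
      · rw [Real.log_div one_ne_zero hc0.ne', Real.log_one]; linarith
      · rw [Real.log_div ht.ne' hc0.ne', one_div, Real.log_inv]; linarith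
    · rw [indicator_of_notMem hx, if_pos (hφ x hx), Real.log_div one_ne_zero hc0.ne', Real.log_one]
      linarith
  have hGm : Measurable G := measurable_const.add (measurable_const.indicator hD)
  have hGi : Integrable G μ := (integrable_const _).add ((integrable_const _).indicator hD)
  have hGint : ∫ x, G x ∂μ = Real.log c + μ.real D * Real.log (1 / t) := by
    simp only [hG]
    rw [integral_add (integrable_const _) ((integrable_const _).indicator hD),
      integral_indicator_const _ hD]
    simp
  have key := entH_le_add_integral (μ := μ) (measurable_word hT.measurable hξ n)
    (measurable_word hT.measurable hζ n) (fun b a => ∏ l, q (b l) (a l))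
    (fun b a => Finset.prod_pos fun l _ => hq _ _)
    (fun b => by
      have := Finset.prod_univ_sum (fun _ : Fin n => (Finset.univ : Finset A))
        (fun l a => q (b l) a)
      rw [Fintype.piFinset_univ] at this
      rw [← this]
      exact Finset.prod_le_one (fun l _ => Finset.sum_nonneg fun a _ => (hq _ a).le)
        fun l _ => hq1 _)
  refine key.trans (add_le_add le_rfl ?_)
  have hGl : ∀ l : ℕ, Integrable (fun x => G (T^[l] x)) μ := fun l =>
    (hT.iterate l).integrable_comp_of_integrable hGi
  calc ∫ x, -Real.log (∏ l, q (word T ζ n x l) (word T ξ n x l)) ∂μ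
      ≤ ∫ x, ∑ l : Fin n, G (T^[(l : ℕ)] x) ∂μ := by
        refine integral_mono_of_nonneg ?_ (integrable_finsetSum _ fun l _ => hGl l) ?_
        · refine Eventually.of_forall fun x => ?_
          have h1 : ∏ l, q (word T ζ n x l) (word T ξ n x l) ≤ 1 := by
            refine Finset.prod_le_one (fun l _ => (hq _ _).le) fun l _ => ?_
            exact (Finset.single_le_sum (f := fun a => q (word T ζ n x l) a)
              (fun a _ => (hq _ a).le) (Finset.mem_univ _)).trans (hq1 _)
          have h2 := Real.log_nonpos (Finset.prod_nonneg fun l _ => (hq _ _).le) h1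
          simpa using h2
        · refine Eventually.of_forall fun x => ?_
          simp only
          rw [Real.log_prod (fun l _ => (hq _ _).ne'), ← Finset.sum_neg_distrib]
          exact Finset.sum_le_sum fun l _ => hqG _
    _ = n * (Real.log c + μ.real D * Real.log (1 / t)) := by
        rw [integral_finsetSum (f := fun (l : Fin n) x => G (T^[(l : ℕ)] x)) _ fun l _ => hGl l]
        have : ∀ l : ℕ, ∫ x, G (T^[l] x) ∂μ = ∫ x, G x ∂μ := fun l => by
          conv_rhs => rw [← (hT.iterate l).map_eq]
          rw [integral_map (hT.iterate l).aemeasurable hGm.aestronglyMeasurable]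
        simp only [this, hGint]
        simp only [Finset.sum_const, Finset.card_univ, Fintype.card_fin, nsmul_eq_mul]

end Symbols

/-- truncation of a real number to the unit interval. -/
noncomputable def clip (r : ℝ) : ℝ := max 0 (min 1 r)

lemma clip_nonneg (r : ℝ) : 0 ≤ clip r := le_max_left _ _

lemma clip_le_one (r : ℝ) : clip r ≤ 1 := max_le zero_le_one (min_le_left _ _)

lemma clip_of_mem {r : ℝ} (h0 : 0 ≤ r) (h1 : r ≤ 1) : clip r = r := by
  rw [clip, min_eq_right h1, max_eq_right h0]

lemma continuous_clip : Continuous clip := continuous_const.max (continuous_const.min continuous_id)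

lemma negMulLog_le_one {p : ℝ} (h0 : 0 ≤ p) : Real.negMulLog p ≤ 1 := by
  rcases h0.eq_or_lt with h | h
  · rw [← h]; simp
  · have := Real.log_le_sub_one_of_pos (inv_pos.2 h)
    rw [Real.log_inv] at this
    have h2 := mul_le_mul_of_nonneg_left this h.le
    rw [mul_sub, mul_inv_cancel₀ h.ne'] at h2
    rw [Real.negMulLog]
    linarith

section Conditional

variable {X : Type*} {A W : Type*} [mX : MeasurableSpace X] [MeasurableSpace A]
  [mW : MeasurableSpace W]
  [Fintype A] [Fintype W] [MeasurableSingletonClass A] [MeasurableSingletonClass W]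
  {μ : Measure X}

lemma condExp_fiber [IsProbabilityMeasure μ] {ζ : X → W} (hζ : Measurable ζ) {B : Set X}
    (hB : MeasurableSet B) :
    (fun x => μ.real (B ∩ ζ ⁻¹' {ζ x}) / μ.real (ζ ⁻¹' {ζ x}))
      =ᵐ[μ] μ[B.indicator (fun _ => (1 : ℝ)) | mW.comap ζ] := by
  have hm : mW.comap ζ ≤ mX := hζ.comap_le
  set c : W → ℝ := fun w => μ.real (B ∩ ζ ⁻¹' {w}) / μ.real (ζ ⁻¹' {w}) with hc
  have hcm : Measurable c := measurable_of_finite c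
  have hci : Integrable (fun x => c (ζ x)) μ := by
    have : Integrable c (μ.map ζ) := Integrable.of_finite
    exact (integrable_map_measure hcm.aestronglyMeasurable hζ.aemeasurable).1 this
  refine ae_eq_condExp_of_forall_setIntegral_eq hm ((integrable_const _).indicator hB)
    (fun s _ _ => hci.integrableOn) ?_ ?_
  · rintro s ⟨S, hS, rfl⟩ -
    have hsm : MeasurableSet (ζ ⁻¹' S) := hζ hS
    have h1 : ∫ x in ζ ⁻¹' S, c (ζ x) ∂μ = ∑ w, μ.real (ζ ⁻¹' {w}) * S.indicator c w := by
      rw [← integral_comp_fintype hζ (S.indicator c), ← integral_indicator hsm]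
      rfl
    have h2 : ∫ x in ζ ⁻¹' S, B.indicator (fun _ => (1 : ℝ)) x ∂μ
        = ∑ w, μ.real (B ∩ ζ ⁻¹' {w}) * S.indicator 1 w := by
      rw [← integral_indicator hsm, indicator_indicator, inter_comm, ← indicator_indicator,
        integral_indicator hB]
      have := integral_comp_fintype (μ := μ.restrict B) hζ (S.indicator 1)
      simp only [measureReal_restrict_apply (hζ (measurableSet_singleton _))] at this
      simp only [inter_comm B]
      rw [← this]
      rfl
    rw [h1, h2]
    refine Finset.sum_congr rfl fun w _ => ?_
    by_cases hw : w ∈ S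
    · rw [indicator_of_mem hw, indicator_of_mem hw, Pi.one_apply, mul_one]
      simp only [hc]
      by_cases h0 : μ.real (ζ ⁻¹' {w}) = 0
      · rw [h0, zero_mul]
        exact le_antisymm measureReal_nonneg ((measureReal_mono inter_subset_right).trans h0.le)
      · field_simp
    · rw [indicator_of_notMem hw, indicator_of_notMem hw]; simp
  · have : Measurable[mW.comap ζ] fun x => c (ζ x) := hcm.comp (comap_measurable ζ)
    exact this.stronglyMeasurable.aestronglyMeasurable

/-- the `σ`-algebra generated by the first `n` symbols after time zero. -/
noncomputable def futFiltration {T : X → X} (hT : Measurable T) {ξ : X → A} (hξ : Measurable ξ) :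
    Filtration ℕ mX where
  seq n := MeasurableSpace.comap (fun x => word T ξ n (T x)) inferInstance
  mono' := by
    intro n n' hn
    have : (fun x => word T ξ n (T x)) =
        (fun (w : Fin n' → A) (l : Fin n) => w (Fin.castLE hn l)) ∘ fun x => word T ξ n' (T x) := by
      funext x l
      simp [word]
    simp only
    rw [this, ← MeasurableSpace.comap_comp]
    exact MeasurableSpace.comap_mono
      (Measurable.comap_le (measurable_pi_lambda _ fun l => measurable_pi_apply _))
  le' n := ((measurable_word hT hξ n).comp hT).comap_le

/-- the `σ`-algebra generated by the whole symbolic orbit. -/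
@[reducible] def fut (T : X → X) (ξ : X → A) : MeasurableSpace X :=
  ⨆ l : ℕ, MeasurableSpace.comap (fun x => ξ (T^[l] x)) inferInstance

omit [Fintype A] [MeasurableSingletonClass A] mX in
lemma measurable_fut_iterate (T : X → X) (ξ : X → A) (l : ℕ) :
    Measurable[fut T ξ] fun x => ξ (T^[l] x) :=
  Measurable.mono (comap_measurable _)
    (le_iSup (fun l : ℕ => MeasurableSpace.comap (fun x => ξ (T^[l] x)) inferInstance) l) le_rfl

omit [Fintype A] [MeasurableSingletonClass A] in
lemma fut_le {T : X → X} (hT : Measurable T) {ξ : X → A} (hξ : Measurable ξ) : fut T ξ ≤ mX :=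
  iSup_le fun l => (hξ.comp (hT.iterate l)).comap_le

omit [Fintype A] [MeasurableSingletonClass A] mX in
lemma measurable_fut_shift (T : X → X) (ξ : X → A) : Measurable[fut T ξ, fut T ξ] T := by
  refine measurable_iff_comap_le.2 ?_
  rw [fut, MeasurableSpace.comap_iSup]
  refine iSup_le fun l => ?_
  rw [MeasurableSpace.comap_comp]
  exact (measurable_fut_iterate T ξ (l + 1)).comap_le

omit [Fintype A] [MeasurableSingletonClass A] in
lemma iSup_futFiltration_le {T : X → X} (hT : Measurable T) {ξ : X → A} (hξ : Measurable ξ) :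
    ⨆ n, futFiltration hT hξ n ≤ fut T ξ := by
  refine iSup_le fun n => ?_
  refine (@measurable_pi_lambda _ _ _ (fut T ξ) _ _ fun l => ?_ :
    Measurable[fut T ξ] fun x => word T ξ n (T x)).comap_le
  exact measurable_fut_iterate T ξ (l + 1)

omit [Fintype A] [MeasurableSingletonClass A] in
lemma measurable_futFiltration_shift {T : X → X} (hT : Measurable T) {ξ : X → A}
    (hξ : Measurable ξ) : Measurable[⨆ n, futFiltration hT hξ n, fut T ξ] T := by
  refine measurable_iff_comap_le.2 ?_
  rw [fut, MeasurableSpace.comap_iSup]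
  refine iSup_le fun l => ?_
  rw [MeasurableSpace.comap_comp]
  refine le_trans ?_ (le_iSup (fun n => (futFiltration hT hξ) n) (l + 1))
  have : ((fun x => ξ (T^[l] x)) ∘ T) =
      (fun w : Fin (l + 1) → A => w (Fin.last l)) ∘ fun x => word T ξ (l + 1) (T x) := by
    funext x
    simp [word]
  rw [this, ← MeasurableSpace.comap_comp]
  exact MeasurableSpace.comap_mono (measurable_pi_apply _).comap_le

/-- the conditional probability of the symbol `a` given the future symbols. -/
noncomputable def futProb (μ : Measure X) {T : X → X} (hT : Measurable T) {ξ : X → A}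
    (hξ : Measurable ξ) (a : A) (x : X) : ℝ :=
  clip ((μ[(ξ ⁻¹' {a}).indicator (fun _ => (1 : ℝ)) | ⨆ n, futFiltration hT hξ n]) x)

section futProb

variable {T : X → X} (hT : Measurable T) {ξ : X → A} (hξ : Measurable ξ)

omit [Fintype A] [MeasurableSingletonClass A] in
lemma measurable_futProb (a : A) :
    Measurable[⨆ n, futFiltration hT hξ n] (futProb μ hT hξ a) :=
  continuous_clip.measurable.comp stronglyMeasurable_condExp.measurable

omit [Fintype A] in
lemma futProb_ae_eq [IsProbabilityMeasure μ] (a : A) : futProb μ hT hξ a =ᵐ[μ]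
    μ[(ξ ⁻¹' {a}).indicator (fun _ => (1 : ℝ)) | ⨆ n, futFiltration hT hξ n] := by
  have hB : MeasurableSet (ξ ⁻¹' {a}) := hξ (measurableSet_singleton a)
  have h0 := condExp_mono (μ := μ) (m := ⨆ n, futFiltration hT hξ n) (integrable_zero X ℝ μ)
    ((integrable_const (1 : ℝ)).indicator hB)
    (Eventually.of_forall fun x => indicator_nonneg (fun _ _ => zero_le_one) x)
  have h1 := condExp_mono (μ := μ) (m := ⨆ n, futFiltration hT hξ n)
    ((integrable_const (1 : ℝ)).indicator hB) (integrable_const (1 : ℝ))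
    (Eventually.of_forall fun x => indicator_le_self' (fun _ _ => zero_le_one) x)
  rw [condExp_const (iSup_le fun n => (futFiltration hT hξ).le n)] at h1
  filter_upwards [h0, h1] with x h0 h1
  rw [condExp_zero] at h0
  exact clip_of_mem h0 h1

omit [Fintype A] in
lemma lintegral_futProb [IsProbabilityMeasure μ] (a : A) {ψ : X → ℝ≥0∞}
    (hψ : Measurable[⨆ n, futFiltration hT hξ n] ψ) :
    ∫⁻ x in ξ ⁻¹' {a}, ψ x ∂μ = ∫⁻ x, ENNReal.ofReal (futProb μ hT hξ a x) * ψ x ∂μ := by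
  have hB : MeasurableSet (ξ ⁻¹' {a}) := hξ (measurableSet_singleton a)
  have hm : (⨆ n, futFiltration hT hξ n) ≤ mX := iSup_le fun n => (futFiltration hT hξ).le n
  have hpm : Measurable fun x => ENNReal.ofReal (futProb μ hT hξ a x) :=
    ENNReal.measurable_ofReal.comp ((measurable_futProb hT hξ a).mono hm le_rfl)
  have hpi : Integrable (futProb μ hT hξ a) μ := integrable_of_abs_le
    ((measurable_futProb hT hξ a).mono hm le_rfl) (C := 1) fun x => by
      rw [futProb, abs_of_nonneg (clip_nonneg _)]; exact clip_le_one _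
  have hν : (μ.restrict (ξ ⁻¹' {a})).trim hm =
      (μ.withDensity fun x => ENNReal.ofReal (futProb μ hT hξ a x)).trim hm := by
    refine @Measure.ext _ (⨆ n, futFiltration hT hξ n) _ _ fun s hs => ?_
    rw [trim_measurableSet_eq hm hs, trim_measurableSet_eq hm hs,
      withDensity_apply _ (hm s hs), Measure.restrict_apply (hm s hs),
      ← ofReal_integral_eq_lintegral_ofReal hpi.integrableOn
        (Eventually.of_forall fun x => clip_nonneg _),
      setIntegral_congr_ae (hm s hs) ((futProb_ae_eq (μ := μ) hT hξ a).mono fun x hx _ => hx),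
      setIntegral_condExp hm ((integrable_const _).indicator hB) hs,
      setIntegral_indicator hB]
    simp
  rw [← lintegral_trim hm hψ, hν, lintegral_trim hm hψ,
    lintegral_withDensity_eq_lintegral_mul _ hpm (hψ.mono hm le_rfl)]
  rfl

lemma entH_word_succ_sub [IsProbabilityMeasure μ] (hTμ : μ.map T = μ) (n : ℕ) :
    entH μ (fib (word T ξ (n + 1))) - entH μ (fib (word T ξ n)) =
      ∑ a, ∫ x, Real.negMulLog (clip
        ((μ[(ξ ⁻¹' {a}).indicator (fun _ => (1 : ℝ)) | futFiltration hT hξ n]) x)) ∂μ := by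
  set ζ : X → (Fin n → A) := fun x => word T ξ n (T x) with hζdef
  have hζ : Measurable ζ := (measurable_word hT hξ n).comp hT
  set S : A → (Fin n → A) → ℝ := fun a w => μ.real (ξ ⁻¹' {a} ∩ ζ ⁻¹' {w}) with hS
  set r : (Fin n → A) → ℝ := fun w => μ.real (ζ ⁻¹' {w}) with hr
  have e1 : entH μ (fib (word T ξ n)) = ∑ w, Real.negMulLog (r w) := by
    refine Finset.sum_congr rfl fun w _ => ?_
    simp only [hr, fib, Measure.real]
    conv_lhs => rw [← hTμ]
    rw [Measure.map_apply hT (measurable_word hT hξ n (measurableSet_singleton w))]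
    rfl
  have e2 : entH μ (fib (word T ξ (n + 1))) = ∑ a, ∑ w, Real.negMulLog (S a w) := by
    rw [entH, ← (Fin.consEquiv (fun _ : Fin (n + 1) => A)).sum_comp, Fintype.sum_prod_type]
    refine Finset.sum_congr rfl fun a _ => Finset.sum_congr rfl fun w _ => ?_
    congr 3
    ext x
    simp only [fib, mem_preimage, mem_singleton_iff, mem_inter_iff, Fin.consEquiv, Equiv.coe_fn_mk]
    rw [funext_iff, Fin.forall_fin_succ, funext_iff]
    simp [word, hζdef]
  have hsum : ∀ w, ∑ a, S a w = r w := fun w => by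
    have h1 := integral_comp_fintype (μ := μ.restrict (ζ ⁻¹' {w})) hξ (fun _ => 1)
    have h2 : ∀ a, (μ.restrict (ζ ⁻¹' {w})).real (ξ ⁻¹' {a}) = S a w := fun a =>
      measureReal_restrict_apply (hξ (measurableSet_singleton a))
    simp only [h2, mul_one] at h1
    rw [← h1]
    simp [hr]
  have hSr : ∀ a w, S a w ≤ r w := fun a w => measureReal_mono inter_subset_right
  have e3 : ∀ a, ∫ x, Real.negMulLog (clip
        ((μ[(ξ ⁻¹' {a}).indicator (fun _ => (1 : ℝ)) | futFiltration hT hξ n]) x)) ∂μ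
      = ∑ w, r w * Real.negMulLog (S a w / r w) := by
    intro a
    rw [← integral_comp_fintype hζ (fun w => Real.negMulLog (S a w / r w))]
    refine integral_congr_ae ?_
    filter_upwards [condExp_fiber (μ := μ) hζ (hξ (measurableSet_singleton a))] with x hx
    have h0 : (μ[(ξ ⁻¹' {a}).indicator (fun _ => (1 : ℝ)) | futFiltration hT hξ n]) x
        = S a (ζ x) / r (ζ x) := hx.symm
    rw [h0, clip_of_mem (div_nonneg measureReal_nonneg measureReal_nonneg)
      (div_le_one_of_le₀ (hSr _ _) measureReal_nonneg)]
  rw [e1, e2, Finset.sum_congr rfl fun a _ => e3 a, sub_eq_iff_eq_add]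
  have e4 : ∀ a w, r w * Real.negMulLog (S a w / r w)
      = Real.negMulLog (S a w) + S a w * Real.log (r w) := by
    intro a w
    rcases (measureReal_nonneg : 0 ≤ S a w).eq_or_lt with h | h
    · rw [show S a w = 0 from h.symm]; simp
    · have hr0 := h.trans_le (hSr a w)
      rw [Real.negMulLog, Real.negMulLog, Real.log_div h.ne' hr0.ne']
      field_simp
      ring
  simp only [e4, Finset.sum_add_distrib]
  rw [Finset.sum_comm (f := fun a w => S a w * Real.log (r w))]
  simp only [← Finset.sum_mul, hsum]
  have : ∀ w, Real.negMulLog (r w) = - (r w * Real.log (r w)) := fun w => by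
    rw [Real.negMulLog]; ring
  simp [this]

/-- the entropy of the zeroth symbol given the future. -/
noncomputable def futEnt (μ : Measure X) {T : X → X} (hT : Measurable T) {ξ : X → A}
    (hξ : Measurable ξ) : ℝ :=
  ∑ a, ∫ x, Real.negMulLog (futProb μ hT hξ a x) ∂μ

lemma tendsto_entH_word [IsProbabilityMeasure μ] (hTμ : μ.map T = μ) :
    Tendsto (fun n : ℕ => entH μ (fib (word T ξ n)) / n) atTop (𝓝 (futEnt μ hT hξ)) := by
  have hd : Tendsto (fun n => entH μ (fib (word T ξ (n + 1))) - entH μ (fib (word T ξ n))) atTop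
      (𝓝 (futEnt μ hT hξ)) := by
    simp only [entH_word_succ_sub hT hξ hTμ]
    refine tendsto_finsetSum _ fun a _ => ?_
    refine tendsto_integral_of_dominated_convergence (fun _ => (1 : ℝ)) (fun n => ?_)
      (integrable_const _) (fun n => ?_) ?_
    · exact (Real.continuous_negMulLog.comp continuous_clip).comp_aestronglyMeasurable
        (stronglyMeasurable_condExp.mono ((futFiltration hT hξ).le n)).aestronglyMeasurable
    · refine Eventually.of_forall fun x => ?_
      rw [Real.norm_eq_abs, abs_of_nonneg (Real.negMulLog_nonneg (clip_nonneg _) (clip_le_one _))]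
      exact negMulLog_le_one (clip_nonneg _)
    · filter_upwards [tendsto_ae_condExp (μ := μ) (ℱ := futFiltration hT hξ)
        ((ξ ⁻¹' {a}).indicator (fun _ => (1 : ℝ)))] with x hx
      exact ((Real.continuous_negMulLog.comp continuous_clip).tendsto _).comp hx
  have hc := hd.cesaro
  have h0 : Tendsto (fun n : ℕ => (n : ℝ)⁻¹ * entH μ (fib (word T ξ 0))) atTop (𝓝 0) := by
    simpa using (tendsto_inv_atTop_nhds_zero_nat (𝕜 := ℝ)).mul_const (entH μ (fib (word T ξ 0)))
  have := hc.add h0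
  rw [add_zero] at this
  refine this.congr fun n => ?_
  rw [Finset.sum_range_sub (fun n => entH μ (fib (word T ξ n)))]
  ring

omit [Fintype A] in
lemma integral_futProb [IsProbabilityMeasure μ] (a : A) {ψ : X → ℝ} (h0 : ∀ x, 0 ≤ ψ x)
    (hψ : Measurable[⨆ n, futFiltration hT hξ n] ψ) :
    ∫ x in ξ ⁻¹' {a}, ψ x ∂μ = ∫ x, futProb μ hT hξ a x * ψ x ∂μ := by
  have hm : (⨆ n, futFiltration hT hξ n) ≤ mX := iSup_le fun n => (futFiltration hT hξ).le n
  have hp := measurable_futProb (μ := μ) hT hξ a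
  rw [integral_eq_lintegral_of_nonneg_ae (Eventually.of_forall h0)
      (hψ.mono hm le_rfl).aestronglyMeasurable,
    integral_eq_lintegral_of_nonneg_ae
      (Eventually.of_forall fun x =>
        mul_nonneg (show 0 ≤ futProb μ hT hξ a x from clip_nonneg _) (h0 x))
      ((hp.mono hm le_rfl).mul (hψ.mono hm le_rfl)).aestronglyMeasurable,
    lintegral_futProb hT hξ a hψ.ennreal_ofReal]
  congr 1
  refine lintegral_congr fun x => ?_
  rw [ENNReal.ofReal_mul (show 0 ≤ futProb μ hT hξ a x from clip_nonneg _)]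

/-- A bounded, future-measurable version of the information function: its exponential is an
asymptotic inverse of the conditional probability of a symbol given the future. -/
lemma exists_information [IsProbabilityMeasure μ] (hTμ : μ.map T = μ) {η : ℝ} (hη : 0 < η) :
    ∃ F : X → ℝ, Measurable[fut T ξ] F ∧ (∃ C, ∀ x, |F x| ≤ C) ∧
      futEnt μ hT hξ - η ≤ ∫ x, F x ∂μ ∧
      ∀ (a : A) (φ : X → ℝ≥0∞), Measurable[fut T ξ] φ →
        ∫⁻ x in ξ ⁻¹' {a}, ENNReal.ofReal (Real.exp (F x)) * φ (T x) ∂μ ≤ ∫⁻ x, φ x ∂μ := by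
  set p := futProb μ hT hξ with hp
  have hp0 : ∀ a x, 0 ≤ p a x := fun a x => clip_nonneg _
  have hp1 : ∀ a x, p a x ≤ 1 := fun a x => clip_le_one _
  have hm : (⨆ n, futFiltration hT hξ n) ≤ mX := iSup_le fun n => (futFiltration hT hξ).le n
  have hpm : ∀ a, Measurable[⨆ n, futFiltration hT hξ n] (p a) := measurable_futProb hT hξ
  set G : ℕ → A → X → ℝ := fun M a x => min (-Real.log (p a x)) M with hG
  have hG0 : ∀ M a x, 0 ≤ G M a x := fun M a x =>
    le_min (neg_nonneg.2 (Real.log_nonpos (hp0 a x) (hp1 a x))) (Nat.cast_nonneg M)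
  have hGM : ∀ M a x, G M a x ≤ M := fun M a x => min_le_right _ _
  have hGm : ∀ M a, Measurable[⨆ n, futFiltration hT hξ n] (G M a) := fun M a =>
    ((Real.measurable_log.comp (hpm a)).neg).min measurable_const
  have hlim : Tendsto (fun M : ℕ => ∑ a, ∫ x, p a x * G M a x ∂μ) atTop
      (𝓝 (futEnt μ hT hξ)) := by
    refine tendsto_finsetSum _ fun a _ => ?_
    refine tendsto_integral_of_dominated_convergence (fun _ => (1 : ℝ)) (fun M => ?_)
      (integrable_const _) (fun M => ?_) ?_
    · exact (((hpm a).mul (hGm M a)).mono hm le_rfl).aestronglyMeasurable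
    · refine Eventually.of_forall fun x => ?_
      rw [Real.norm_eq_abs, abs_of_nonneg (mul_nonneg (hp0 a x) (hG0 M a x))]
      refine (mul_le_mul_of_nonneg_left (min_le_left _ _) (hp0 a x)).trans ?_
      have := negMulLog_le_one (hp0 a x)
      rw [Real.negMulLog] at this
      linarith
    · refine Eventually.of_forall fun x => tendsto_const_nhds.congr' ?_
      obtain ⟨M₀, hM₀⟩ := exists_nat_ge (-Real.log (p a x))
      filter_upwards [eventually_ge_atTop M₀] with M hM
      simp only [hG]
      rw [min_eq_left (hM₀.trans (by exact_mod_cast hM)), Real.negMulLog]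
      simp only [hp]
      ring
  obtain ⟨M, hM⟩ := (hlim.eventually (lt_mem_nhds (show futEnt μ hT hξ - η < futEnt μ hT hξ by
    linarith))).exists
  have hFeq : (fun x => G M (ξ x) x) = fun x => ∑ a, (ξ ⁻¹' {a}).indicator (G M a) x := by
    funext x
    rw [Finset.sum_eq_single (ξ x)]
    · rw [indicator_of_mem]; rfl
    · intro b _ hb
      have : x ∉ ξ ⁻¹' {b} := fun h => hb (show ξ x = b from h).symm
      exact indicator_of_notMem this _
    · simp
  refine ⟨fun x => G M (ξ x) x, ?_, ⟨M, fun x => ?_⟩, ?_, fun a φ hφ => ?_⟩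
  · rw [hFeq]
    refine Finset.measurable_sum _ fun a _ => ?_
    exact ((hGm M a).mono (iSup_futFiltration_le hT hξ) le_rfl).indicator
      ((measurable_fut_iterate T ξ 0) (measurableSet_singleton a))
  · rw [abs_of_nonneg (hG0 _ _ _)]; exact hGM _ _ _
  · have h1 : ∫ x, G M (ξ x) x ∂μ = ∑ a, ∫ x, p a x * G M a x ∂μ := by
      rw [hFeq, integral_finsetSum]
      · refine Finset.sum_congr rfl fun a _ => ?_
        rw [integral_indicator (hξ (measurableSet_singleton a))]
        exact integral_futProb hT hξ a (hG0 M a) (hGm M a)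
      · intro a _
        refine Integrable.indicator ?_ (hξ (measurableSet_singleton a))
        exact integrable_of_abs_le ((hGm M a).mono hm le_rfl) (C := M) fun x => by
          rw [abs_of_nonneg (hG0 _ _ _)]; exact hGM _ _ _
    rw [h1]; exact hM.le
  · have hφT : Measurable[⨆ n, futFiltration hT hξ n] fun x => φ (T x) :=
      hφ.comp (measurable_futFiltration_shift hT hξ)
    have hE : Measurable[⨆ n, futFiltration hT hξ n]
        fun x => ENNReal.ofReal (Real.exp (G M a x)) * φ (T x) :=
      (Real.measurable_exp.comp (hGm M a)).ennreal_ofReal.mul hφT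
    calc ∫⁻ x in ξ ⁻¹' {a}, ENNReal.ofReal (Real.exp (G M (ξ x) x)) * φ (T x) ∂μ
        = ∫⁻ x in ξ ⁻¹' {a}, ENNReal.ofReal (Real.exp (G M a x)) * φ (T x) ∂μ :=
          setLIntegral_congr_fun (hξ (measurableSet_singleton a)) fun x hx => by
            rw [show ξ x = a from hx]
      _ = ∫⁻ x, ENNReal.ofReal (p a x) * (ENNReal.ofReal (Real.exp (G M a x)) * φ (T x)) ∂μ :=
          lintegral_futProb hT hξ a hE
      _ ≤ ∫⁻ x, φ (T x) ∂μ := by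
          refine lintegral_mono fun x => ?_
          rw [← mul_assoc, ← ENNReal.ofReal_mul (hp0 a x)]
          refine mul_le_of_le_one_left zero_le (ENNReal.ofReal_le_one.2 ?_)
          rcases (hp0 a x).eq_or_lt with h | h
          · rw [← h]; simp
          · calc p a x * Real.exp (G M a x) ≤ p a x * Real.exp (-Real.log (p a x)) :=
                mul_le_mul_of_nonneg_left (Real.exp_le_exp.2 (min_le_left _ _)) h.le
              _ = 1 := by rw [Real.exp_neg, Real.exp_log h, mul_inv_cancel₀ h.ne']
      _ = ∫⁻ x, φ x ∂μ := by
          conv_rhs => rw [← hTμ]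
          rw [lintegral_map (hφ.mono (fut_le hT hξ) le_rfl) hT]

lemma hPart_fib [IsProbabilityMeasure μ] (hTμ : μ.map T = μ) :
    hPart μ T (fib ξ) = (futEnt μ hT hξ : EReal) := by
  simp only [hPart, dynJoin_fib]
  exact ((continuous_coe_real_ereal.tendsto _).comp (tendsto_entH_word hT hξ hTμ)).liminf_eq

omit [Fintype W] [MeasurableSingletonClass W] [MeasurableSpace W] in
lemma futEnt_le_add [IsProbabilityMeasure μ] (hTμ : μ.map T = μ) {B : Type*} [MeasurableSpace B]
    [Fintype B] [MeasurableSingletonClass B] {ζ : X → B} (hζ : Measurable ζ) (φ : B → A)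
    {D : Set X} (hD : MeasurableSet D) (hφ : ∀ x, x ∉ D → ξ x = φ (ζ x))
    {t : ℝ} (ht : 0 < t) (ht1 : t ≤ 1) :
    futEnt μ hT hξ ≤ futEnt μ hT hζ +
      (Real.log (1 + Fintype.card A * t) + μ.real D * Real.log (1 / t)) := by
  refine le_of_tendsto_of_tendsto (tendsto_entH_word hT hξ hTμ)
    ((tendsto_entH_word hT hζ hTμ).add_const _) ?_
  filter_upwards [eventually_gt_atTop 0] with n hn
  have hn' : (0 : ℝ) < n := by exact_mod_cast hn
  have := entH_word_le_add ⟨hT, hTμ⟩ hξ hζ φ hD hφ ht ht1 n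
  rw [div_le_iff₀ hn']
  refine this.trans (le_of_eq ?_)
  field_simp

end futProb

end Conditional

lemma lintegral_prod_le {X ι B : Type*} [mX : MeasurableSpace X] [Preorder ι] {μ : Measure X}
    [IsProbabilityMeasure μ] {T : X → X} {m : ι → MeasurableSpace X} (hm : Antitone m)
    (hT : ∀ i, Measurable[m i, m i] T) {W : ι → B → X → ℝ≥0∞}
    (hW : ∀ i b, Measurable[m i] (W i b)) {K : ℝ≥0∞}
    (hK : ∀ i b (φ : X → ℝ≥0∞), Measurable[m i] φ →
      ∫⁻ x, W i b x * φ (T x) ∂μ ≤ K * ∫⁻ x, φ x ∂μ)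
    (N : ℕ) (r : ℕ → ι) (hr : ∀ l l', l ≤ l' → l' < N → r l ≤ r l') (v : ℕ → B) :
    ∫⁻ x, ∏ l ∈ Finset.range N, W (r l) (v l) (T^[l] x) ∂μ ≤ K ^ N := by
  induction N generalizing r v with
  | zero => simp
  | succ N ih =>
    have hφ : Measurable[m (r 0)] fun x =>
        ∏ l ∈ Finset.range N, W (r (l + 1)) (v (l + 1)) (T^[l] x) := by
      refine Finset.measurable_fun_prod _ fun l hl => ?_
      have h1 : r 0 ≤ r (l + 1) :=
        hr _ _ (Nat.zero_le _) (Nat.succ_lt_succ (Finset.mem_range.1 hl))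
      exact ((hW _ _).mono (hm h1) le_rfl).comp (@Measurable.iterate X (m (r 0)) T (hT _) l)
    calc ∫⁻ x, ∏ l ∈ Finset.range (N + 1), W (r l) (v l) (T^[l] x) ∂μ
        = ∫⁻ x, W (r 0) (v 0) x *
            ∏ l ∈ Finset.range N, W (r (l + 1)) (v (l + 1)) (T^[l] (T x)) ∂μ := by
          refine lintegral_congr fun x => ?_
          rw [Finset.prod_range_succ', mul_comm]
          rfl
      _ ≤ K * ∫⁻ x, ∏ l ∈ Finset.range N, W (r (l + 1)) (v (l + 1)) (T^[l] x) ∂μ :=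
          hK _ _ _ hφ
      _ ≤ K * K ^ N := by
          gcongr
          exact ih _ (fun l l' h h' => hr _ _ (Nat.succ_le_succ h) (Nat.succ_lt_succ h')) _
      _ = K ^ (N + 1) := (pow_succ' K N).symm

lemma lintegral_weight_le {X A : Type*} [MeasurableSpace X] [MeasurableSpace A] [Fintype A]
    [MeasurableSingletonClass A] {μ : Measure X} {ξ : X → A} (hξ : Measurable ξ)
    {ψ : X → ℝ≥0∞} {c : ℝ≥0∞} (hψ : ∀ a, ∫⁻ x in ξ ⁻¹' {a}, ψ x ∂μ ≤ c) {g : A → ℝ≥0∞}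
    (hg : ∀ a, g a ≠ ∞) :
    ∫⁻ x, g (ξ x) * ψ x ∂μ ≤ (∑ a, g a) * c := by
  have hU : ⋃ a ∈ (Finset.univ : Finset A), ξ ⁻¹' {a} = univ :=
    eq_univ_of_forall fun x => mem_iUnion₂.2 ⟨ξ x, Finset.mem_univ _, rfl⟩
  rw [← setLIntegral_univ, ← hU, lintegral_biUnion_finset]
  · rw [Finset.sum_mul]
    refine Finset.sum_le_sum fun a _ => ?_
    calc ∫⁻ x in ξ ⁻¹' {a}, g (ξ x) * ψ x ∂μ = ∫⁻ x in ξ ⁻¹' {a}, g a * ψ x ∂μ :=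
          setLIntegral_congr_fun (hξ (measurableSet_singleton a)) fun x hx => by
            rw [show ξ x = a from hx]
      _ = g a * ∫⁻ x in ξ ⁻¹' {a}, ψ x ∂μ := lintegral_const_mul' _ _ (hg a)
      _ ≤ g a * c := by gcongr; exact hψ a
  · intro a _ b _ hab
    exact disjoint_left.2 fun x hx hx' => hab ((show ξ x = a from hx).symm.trans hx')
  · exact fun a _ => hξ (measurableSet_singleton a)

lemma sum_prod_compat_le {J : Type*} [Fintype J] [DecidableEq J] {S : J → Type*}
    [∀ j, Fintype (S j)] [∀ j, DecidableEq (S j)]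
    (z v : ∀ j, S j) {t : ℝ} (ht : 0 ≤ t) :
    ∑ c : ∀ j, S j, ∏ j, (if c j = z j then t else if c j = v j then 1 else 0)
      ≤ (1 + t) ^ Fintype.card J := by
  rw [← Fintype.prod_sum (fun j (b : S j) =>
    (if b = z j then t else if b = v j then (1 : ℝ) else 0)), ← Finset.card_univ,
    ← Finset.prod_const]
  refine Finset.prod_le_prod (fun j _ => Finset.sum_nonneg fun b _ => by positivity) fun j _ => ?_
  calc ∑ b, (if b = z j then t else if b = v j then (1 : ℝ) else 0)
      ≤ ∑ b, ((if b = z j then t else 0) + if b = v j then (1 : ℝ) else 0) := by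
        refine Finset.sum_le_sum fun b _ => ?_
        split_ifs <;> linarith
    _ = 1 + t := by
        rw [Finset.sum_add_distrib, Finset.sum_ite_eq' , Finset.sum_ite_eq']
        simp [add_comm]

/-- cumulative weight of the levels strictly below `i`. -/
noncomputable def cwl (a : Fin k → ℝ) (i : Fin k) : ℝ := ∑ j ∈ Finset.Iio i, a j

lemma cw_eq (a : Fin k → ℝ) (i : Fin k) : cw a i = a i + cwl a i := by
  rw [cw, cwl, ← Finset.Iio_insert, Finset.sum_insert (by simp)]

lemma cwl_nonneg {a : Fin k → ℝ} (ha : ∀ i, 0 ≤ a i) (i : Fin k) : 0 ≤ cwl a i :=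
  Finset.sum_nonneg fun j _ => ha j

lemma cw_nonneg {a : Fin k → ℝ} (ha : ∀ i, 0 ≤ a i) (i : Fin k) : 0 ≤ cw a i :=
  Finset.sum_nonneg fun j _ => ha j

lemma cw_mono {a : Fin k → ℝ} (ha : ∀ i, 0 ≤ a i) : Monotone (cw a) := fun _ _ h =>
  Finset.sum_le_sum_of_subset_of_nonneg (Finset.Iic_subset_Iic.2 h) fun j _ _ => ha j

lemma cw_le_sum {a : Fin k → ℝ} (ha : ∀ i, 0 ≤ a i) (i : Fin k) : cw a i ≤ ∑ j, a j :=
  Finset.sum_le_sum_of_subset_of_nonneg (Finset.subset_univ _) fun j _ _ => ha j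

lemma ceil_cw_mono {a : Fin k → ℝ} (ha : ∀ i, 0 ≤ a i) (n : ℕ) :
    Monotone fun i => ⌈cw a i * (n : ℝ)⌉₊ := fun _ _ h =>
  Nat.ceil_mono (mul_le_mul_of_nonneg_right (cw_mono ha h) (Nat.cast_nonneg n))

lemma ceil_cwl_le_iff {a : Fin k → ℝ} (ha : ∀ i, 0 ≤ a i) (n : ℕ) (i : Fin k) (l : ℕ) :
    ⌈cwl a i * (n : ℝ)⌉₊ ≤ l ↔ ∀ j < i, ⌈cw a j * (n : ℝ)⌉₊ ≤ l := by
  constructor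
  · intro h j hj
    refine le_trans (Nat.ceil_mono (mul_le_mul_of_nonneg_right ?_ (Nat.cast_nonneg n))) h
    exact Finset.sum_le_sum_of_subset_of_nonneg (fun x hx => by
      rw [Finset.mem_Iic] at hx; exact Finset.mem_Iio.2 (hx.trans_lt hj)) fun j _ _ => ha j
  · intro h
    rcases (Finset.Iio i).eq_empty_or_nonempty with he | hne
    · simp [cwl, he]
    · have hmem := Finset.mem_Iio.1 (Finset.max'_mem _ hne)
      have : Finset.Iio i = Finset.Iic ((Finset.Iio i).max' hne) := by
        ext x
        rw [Finset.mem_Iic]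
        exact ⟨fun hx => Finset.le_max' _ _ hx, fun hx => Finset.mem_Iio.2 (hx.trans_lt hmem)⟩
      have h2 := h _ hmem
      rwa [cw, ← this] at h2

/-- the weighted Birkhoff sum in which the function `F i` is summed over the times between the
horizons of the levels `i - 1` and `i`. -/
noncomputable def levelSum {X : Type*} (T : X → X) (a : Fin k → ℝ) (F : Fin k → X → ℝ) (n : ℕ)
    (x : X) : ℝ :=
  ∑ i, (birk T (F i) ⌈cw a i * (n : ℝ)⌉₊ x - birk T (F i) ⌈cwl a i * (n : ℝ)⌉₊ x)

/-- for every time before the largest horizon, the first level whose horizon is later. -/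
lemma exists_level {a : Fin k → ℝ} (n : ℕ) (l : ℕ) [NeZero k] :
    ∃ i : Fin k, l < Finset.univ.sup (fun i : Fin k => ⌈cw a i * (n : ℝ)⌉₊) →
      l < ⌈cw a i * (n : ℝ)⌉₊ ∧ ∀ j < i, ⌈cw a j * (n : ℝ)⌉₊ ≤ l := by
  by_cases h : l < Finset.univ.sup (fun i : Fin k => ⌈cw a i * (n : ℝ)⌉₊)
  · obtain ⟨i, -, hi⟩ := Finset.lt_sup_iff.1 h
    obtain ⟨i₀, h0, h1⟩ := wellFounded_lt.has_min {i : Fin k | l < ⌈cw a i * (n : ℝ)⌉₊} ⟨i, hi⟩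
    exact ⟨i₀, fun _ => ⟨h0, fun j hj => not_lt.1 fun hlt => h1 j hlt hj⟩⟩
  · exact ⟨0, fun h' => absurd h' h⟩

lemma sum_level_eq_levelSum {X : Type*} (T : X → X) {a : Fin k → ℝ} (ha : ∀ i, 0 ≤ a i)
    (F : Fin k → X → ℝ) (n : ℕ) (x : X) {r : ℕ → Fin k}
    (hr : ∀ l, l < Finset.univ.sup (fun i : Fin k => ⌈cw a i * (n : ℝ)⌉₊) →
      l < ⌈cw a (r l) * (n : ℝ)⌉₊ ∧ ∀ j < r l, ⌈cw a j * (n : ℝ)⌉₊ ≤ l) :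
    ∑ l ∈ Finset.range (Finset.univ.sup (fun i : Fin k => ⌈cw a i * (n : ℝ)⌉₊)),
      F (r l) (T^[l] x) = levelSum T a F n x := by
  set N := Finset.univ.sup (fun i : Fin k => ⌈cw a i * (n : ℝ)⌉₊) with hN
  rw [levelSum, ← Finset.sum_fiberwise (Finset.range N) r]
  refine Finset.sum_congr rfl fun i _ => ?_
  have hle : ⌈cwl a i * (n : ℝ)⌉₊ ≤ ⌈cw a i * (n : ℝ)⌉₊ := Nat.ceil_mono
    (mul_le_mul_of_nonneg_right (by rw [cw_eq]; linarith [ha i]) (Nat.cast_nonneg n))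
  have hset : (Finset.range N).filter (fun l => r l = i) =
      Finset.Ico ⌈cwl a i * (n : ℝ)⌉₊ ⌈cw a i * (n : ℝ)⌉₊ := by
    ext l
    rw [Finset.mem_filter, Finset.mem_range, Finset.mem_Ico, ceil_cwl_le_iff ha]
    constructor
    · rintro ⟨h, rfl⟩
      exact (hr l h).symm
    · rintro ⟨h1, h2⟩
      have hlN : l < N := h2.trans_le
        (Finset.le_sup (f := fun i : Fin k => ⌈cw a i * (n : ℝ)⌉₊) (Finset.mem_univ i))
      refine ⟨hlN, le_antisymm (not_lt.1 fun hlt => ?_) (not_lt.1 fun hlt => ?_)⟩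
      · exact ((hr l hlN).2 _ hlt).not_gt h2
      · exact (h1 _ hlt).not_gt (hr l hlN).1
  rw [birk, birk, ← Finset.sum_Ico_eq_sub _ hle, ← hset]
  refine Finset.sum_congr rfl fun l hl => ?_
  rw [(Finset.mem_filter.1 hl).2]

lemma sup_ceil_le {a : Fin k → ℝ} (ha : ∀ i, 0 ≤ a i) {n : ℕ} (hn : 1 ≤ n) :
    ((Finset.univ.sup (fun i : Fin k => ⌈cw a i * (n : ℝ)⌉₊) : ℕ) : ℝ)
      ≤ ((∑ i, a i) + 1) * n := by
  have hn' : (1 : ℝ) ≤ n := by exact_mod_cast hn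
  have hs : 0 ≤ ∑ i, a i := Finset.sum_nonneg fun i _ => ha i
  have h : Finset.univ.sup (fun i : Fin k => ⌈cw a i * (n : ℝ)⌉₊) ≤ ⌈(∑ i, a i) * (n : ℝ)⌉₊ :=
    Finset.sup_le fun i _ => Nat.ceil_mono
      (mul_le_mul_of_nonneg_right (cw_le_sum ha i) (Nat.cast_nonneg n))
  have h2 := (Nat.ceil_lt_add_one (mul_nonneg hs (Nat.cast_nonneg n))).le
  have h3 : ((Finset.univ.sup (fun i : Fin k => ⌈cw a i * (n : ℝ)⌉₊) : ℕ) : ℝ)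
    ≤ (⌈(∑ i, a i) * (n : ℝ)⌉₊ : ℝ) := by exact_mod_cast h
  nlinarith

section Coding

variable {X : Type*} [mX : MeasurableSpace X] {μ : Measure X} {T : X → X}

/-- the joint symbol of all levels from `i` on. -/
def jointSym {S : Fin k → Type*} (ξ : ∀ j, X → S j) (i : Fin k) (x : X) :
    ∀ j : {j : Fin k // i ≤ j}, S j := fun j => ξ j x

lemma measurable_jointSym {S : Fin k → Type*} [∀ j, MeasurableSpace (S j)] {ξ : ∀ j, X → S j}
    (hξ : ∀ j, Measurable (ξ j)) (i : Fin k) : Measurable (jointSym ξ i) :=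
  measurable_pi_lambda _ fun j => hξ j

omit mX in
lemma antitone_fut_jointSym {S : Fin k → Type*} [∀ j, MeasurableSpace (S j)] (T : X → X)
    (ξ : ∀ j, X → S j) : Antitone fun i => fut T (jointSym ξ i) := by
  intro i i' h
  refine iSup_le fun l => ?_
  have h1 : (fun x => jointSym ξ i' (T^[l] x)) =
      (fun (w : ∀ j : {j : Fin k // i ≤ j}, S j) (j : {j : Fin k // i' ≤ j}) =>
        w ⟨j, h.trans j.2⟩) ∘ fun x => jointSym ξ i (T^[l] x) := rfl
  rw [h1]
  exact ((measurable_pi_lambda _ fun j => measurable_pi_apply _).comp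
    (measurable_fut_iterate T (jointSym ξ i) l)).comap_le

lemma exists_coding [NeZero k] [IsProbabilityMeasure μ] (hT : Measurable T) (hTμ : μ.map T = μ)
    {m : Fin k → ℕ} {ξ : ∀ j, X → Fin (m j + 1)} (hξ : ∀ j, Measurable (ξ j))
    {a : Fin k → ℝ} (ha : ∀ i, 0 ≤ a i) {𝒱 : Fin k → Set (Set X)}
    (h𝒱 : ∀ j, ∀ V ∈ 𝒱 j, ∃ v, ∀ x ∈ V, ξ j x = 0 ∨ ξ j x = v)
    {δ t : ℝ} (hδ : ∀ j, μ.real (ξ j ⁻¹' {0}) ≤ δ) (ht : 0 < t) (ht1 : t ≤ 1)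
    {η : ℝ} (hη : 0 < η) :
    ∃ F : Fin k → X → ℝ, (∀ i, Measurable (F i)) ∧ (∀ i, ∃ C, ∀ x, |F i x| ≤ C) ∧
      (∀ i, futEnt μ hT (measurable_jointSym hξ i) - k * δ * Real.log (1 / t) - η
        ≤ ∫ x, F i x ∂μ) ∧
      ∀ n : ℕ, 1 ≤ n → ∀ A, MeasurableSet A → (∃ B ∈ jointFiber T a 𝒱 n, A ⊆ B) →
        ∫⁻ x in A, ENNReal.ofReal (Real.exp (levelSum T a F n x)) ∂μ ≤
          ENNReal.ofReal (Real.exp (k * ((∑ i, a i) + 1) * Real.log (1 + t) * n)) := by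
  have hlt : Real.log t ≤ 0 := Real.log_nonpos ht.le ht1
  choose F hFm hFb hFi hF using fun i : Fin k =>
    exists_information (μ := μ) hT (measurable_jointSym hξ i) hTμ hη
  -- the correction term charging the ambiguous symbol
  set z : Fin k → X → ℝ := fun i x => ∑ j : {j : Fin k // i ≤ j},
    (ξ j ⁻¹' {0}).indicator (fun _ => Real.log t) x with hz
  have hξf : ∀ i (j : {j : Fin k // i ≤ j}), Measurable[fut T (jointSym ξ i)] (ξ j) := fun i j =>
    (measurable_pi_apply j).comp (measurable_fut_iterate T (jointSym ξ i) 0)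
  have hzm : ∀ i, Measurable[fut T (jointSym ξ i)] (z i) := fun i =>
    Finset.measurable_sum _ fun j _ => measurable_const.indicator
      (hξf i j (measurableSet_singleton _))
  have hle : ∀ i, fut T (jointSym ξ i) ≤ mX := fun i => fut_le hT (measurable_jointSym hξ i)
  have hzb : ∀ i x, |z i x| ≤ k * |Real.log t| := fun i x => by
    refine (Finset.abs_sum_le_sum_abs _ _).trans ?_
    calc ∑ j : {j : Fin k // i ≤ j}, |(ξ j ⁻¹' {0}).indicator (fun _ => Real.log t) x|
        ≤ ∑ j : {j : Fin k // i ≤ j}, |Real.log t| := by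
          refine Finset.sum_le_sum fun j _ => ?_
          by_cases h : x ∈ ξ j ⁻¹' {0}
          · rw [indicator_of_mem h]
          · rw [indicator_of_notMem h]; simp
      _ ≤ k * |Real.log t| := by
          rw [Finset.sum_const, nsmul_eq_mul]
          gcongr
          simpa using Fintype.card_subtype_le (fun j : Fin k => i ≤ j)
  have hFint : ∀ i, Integrable (F i) μ := fun i =>
    integrable_of_abs_le ((hFm i).mono (hle i) le_rfl) (hFb i).choose_spec
  have hzint : ∀ i, Integrable (z i) μ := fun i =>
    integrable_of_abs_le ((hzm i).mono (hle i) le_rfl) (hzb i)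
  refine ⟨fun i x => F i x + z i x, fun i => ((hFm i).add (hzm i)).mono (hle i) le_rfl, ?_, ?_, ?_⟩
  · intro i
    obtain ⟨C, hC⟩ := hFb i
    exact ⟨C + k * |Real.log t|, fun x => (abs_add_le _ _).trans (add_le_add (hC x) (hzb i x))⟩
  · intro i
    rw [integral_add (hFint i) (hzint i)]
    have h1 : ∫ x, z i x ∂μ = ∑ j : {j : Fin k // i ≤ j}, μ.real (ξ j ⁻¹' {0}) * Real.log t := by
      simp only [hz]
      rw [integral_finsetSum]
      · refine Finset.sum_congr rfl fun j _ => ?_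
        rw [integral_indicator_const _ (hξ j (measurableSet_singleton _)), smul_eq_mul]
      · exact fun j _ => (integrable_const _).indicator (hξ j (measurableSet_singleton _))
    have h2 : -(k * δ * Real.log (1 / t)) ≤ ∫ x, z i x ∂μ := by
      rw [h1, one_div, Real.log_inv]
      calc -(k * δ * -Real.log t) = k * (δ * Real.log t) := by ring
        _ ≤ (Fintype.card {j : Fin k // i ≤ j}) * (δ * Real.log t) := by
            refine mul_le_mul_of_nonpos_right ?_ (mul_nonpos_of_nonneg_of_nonpos
              (measureReal_nonneg.trans (hδ 0)) hlt)
            exact_mod_cast (by simpa using Fintype.card_subtype_le (fun j : Fin k => i ≤ j))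
        _ = ∑ j : {j : Fin k // i ≤ j}, δ * Real.log t := by simp
        _ ≤ _ := Finset.sum_le_sum fun j _ => mul_le_mul_of_nonpos_right (hδ j) hlt
    linarith [hFi i]
  · intro n hn A hA hAB
    obtain ⟨B, ⟨V, hV, rfl⟩, hAB⟩ := hAB
    choose r hr using fun l => exists_level (k := k) (a := a) n l
    choose! v hv using h𝒱
    set w : ℕ → ∀ j, Fin (m j + 1) := fun l j => v j (V j l) with hw
    -- the weight of a point at level `i`, for a word of symbols
    set g : ∀ i, (∀ j, Fin (m j + 1)) → (∀ j : {j : Fin k // i ≤ j}, Fin (m j + 1)) → ℝ :=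
      fun i b c => ∏ j, (if c j = 0 then t else if c j = b j then 1 else 0) with hg
    have hg0 : ∀ i b c, 0 ≤ g i b c := fun i b c => Finset.prod_nonneg fun j _ => by positivity
    set W : Fin k → (∀ j, Fin (m j + 1)) → X → ℝ≥0∞ := fun i b x =>
      ENNReal.ofReal (g i b (jointSym ξ i x)) * ENNReal.ofReal (Real.exp (F i x)) with hW
    have hWm : ∀ i b, Measurable[fut T (jointSym ξ i)] (W i b) := fun i b => by
      refine Measurable.mul (Measurable.ennreal_ofReal ?_)
        (Real.measurable_exp.comp (hFm i)).ennreal_ofReal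
      exact (measurable_of_finite (g i b)).comp (measurable_fut_iterate T (jointSym ξ i) 0)
    have hK : ∀ i b (φ : X → ℝ≥0∞), Measurable[fut T (jointSym ξ i)] φ →
        ∫⁻ x, W i b x * φ (T x) ∂μ ≤ ENNReal.ofReal ((1 + t) ^ k) * ∫⁻ x, φ x ∂μ := by
      intro i b φ hφ
      simp only [hW, mul_assoc]
      refine (lintegral_weight_le (measurable_jointSym hξ i)
        (g := fun c => ENNReal.ofReal (g i b c)) (fun c => hF i c φ hφ)
        fun _ => ENNReal.ofReal_ne_top).trans ?_
      gcongr
      rw [← ENNReal.ofReal_sum_of_nonneg fun c _ => hg0 i b c]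
      refine ENNReal.ofReal_le_ofReal ?_
      refine (sum_prod_compat_le (fun j : {j : Fin k // i ≤ j} => (0 : Fin (m j + 1)))
        (fun j => b j) ht.le).trans ?_
      refine pow_le_pow_right₀ (by linarith) ?_
      simpa using Fintype.card_subtype_le (fun j : Fin k => i ≤ j)
    set N := Finset.univ.sup (fun i : Fin k => ⌈cw a i * (n : ℝ)⌉₊) with hN
    have hrmono : ∀ l l', l ≤ l' → l' < N → r l ≤ r l' := fun l l' h h' =>
      not_lt.1 fun hlt => (((hr l (h.trans_lt h')).2 _ hlt).trans h).not_gt (hr l' h').1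
    have hprod := lintegral_prod_le (μ := μ) (antitone_fut_jointSym T ξ)
      (fun i => measurable_fut_shift T (jointSym ξ i)) hWm hK N r hrmono w
    have hpt : ∀ x ∈ A, ENNReal.ofReal (Real.exp (levelSum T a (fun i x => F i x + z i x) n x)) =
        ∏ l ∈ Finset.range N, W (r l) (w l) (T^[l] x) := by
      intro x hx
      rw [← sum_level_eq_levelSum T ha _ n x hr, Real.exp_sum,
        ENNReal.ofReal_prod_of_nonneg fun _ _ => (Real.exp_pos _).le]
      refine Finset.prod_congr rfl fun l hl => ?_
      have hlN := Finset.mem_range.1 hl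
      simp only [hW]
      rw [Real.exp_add, mul_comm, ENNReal.ofReal_mul (Real.exp_pos _).le]
      congr 2
      simp only [hz, hg, Real.exp_sum]
      refine Finset.prod_congr rfl fun j _ => ?_
      have hlj : l < ⌈cw a j * (n : ℝ)⌉₊ := (hr l hlN).1.trans_le (ceil_cw_mono ha n j.2)
      have hmem : T^[l] x ∈ V j l := by
        have := mem_iInter.1 (hAB hx) j
        exact mem_iInter₂.1 this l (Finset.mem_range.2 hlj)
      have hcomp := hv j (V j l) (hV j l hlj) _ hmem
      simp only [jointSym, hw]
      by_cases h0 : ξ j (T^[l] x) = 0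
      · rw [if_pos h0, indicator_of_mem (show T^[l] x ∈ ξ j ⁻¹' {0} from h0), Real.exp_log ht]
      · rw [if_neg h0, if_pos (hcomp.resolve_left h0),
          indicator_of_notMem (show T^[l] x ∉ ξ j ⁻¹' {0} from h0), Real.exp_zero]
    calc ∫⁻ x in A, ENNReal.ofReal (Real.exp (levelSum T a (fun i x => F i x + z i x) n x)) ∂μ
        = ∫⁻ x in A, ∏ l ∈ Finset.range N, W (r l) (w l) (T^[l] x) ∂μ :=
          setLIntegral_congr_fun hA hpt
      _ ≤ ∫⁻ x, ∏ l ∈ Finset.range N, W (r l) (w l) (T^[l] x) ∂μ := setLIntegral_le_lintegral _ _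
      _ ≤ ENNReal.ofReal ((1 + t) ^ k) ^ N := hprod
      _ ≤ _ := by
          rw [← ENNReal.ofReal_pow (by positivity)]
          refine ENNReal.ofReal_le_ofReal ?_
          have h1 : ((1 + t) ^ k) ^ N = Real.exp (k * Real.log (1 + t) * N) := by
            rw [← pow_mul, ← Real.exp_log (show (0 : ℝ) < 1 + t by linarith), ← Real.exp_nat_mul]
            rw [Real.log_exp]; push_cast; ring_nf
          rw [h1]
          refine Real.exp_le_exp.2 ?_
          have hl : 0 ≤ k * Real.log (1 + t) :=
            mul_nonneg (Nat.cast_nonneg k) (Real.log_nonneg (by linarith))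
          calc k * Real.log (1 + t) * N
              ≤ k * Real.log (1 + t) * (((∑ i, a i) + 1) * n) :=
                mul_le_mul_of_nonneg_left (sup_ceil_le ha hn) hl
            _ = _ := by ring

end Coding

section Pressure

variable {X : Type*} [MeasurableSpace X] {μ : Measure X} {T : X → X}

omit [MeasurableSpace X] in
lemma tendsto_birk_ceil {F : X → ℝ} {x : X} {g c : ℝ} (hc : 0 ≤ c)
    (h : Tendsto (fun n : ℕ => birk T F n x / n) atTop (𝓝 g)) :
    Tendsto (fun n : ℕ => birk T F ⌈c * (n : ℝ)⌉₊ x / n) atTop (𝓝 (c * g)) := by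
  rcases hc.eq_or_lt with rfl | hc
  · simp [birk]
  · have h1 : Tendsto (fun n : ℕ => ⌈c * (n : ℝ)⌉₊) atTop atTop :=
      tendsto_nat_ceil_atTop.comp (tendsto_natCast_atTop_atTop.const_mul_atTop hc)
    have h2 : Tendsto (fun n : ℕ => (⌈c * (n : ℝ)⌉₊ : ℝ) / n) atTop (𝓝 c) :=
      (tendsto_nat_ceil_mul_div_atTop hc.le).comp tendsto_natCast_atTop_atTop
    refine (h2.mul (h.comp h1)).congr' ?_
    filter_upwards [eventually_gt_atTop 0] with n hn
    have hn' : (0 : ℝ) < n := by exact_mod_cast hn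
    have : (⌈c * (n : ℝ)⌉₊ : ℝ) ≠ 0 := by
      have : 0 < ⌈c * (n : ℝ)⌉₊ := Nat.ceil_pos.2 (mul_pos hc hn')
      exact_mod_cast this.ne'
    simp only [Function.comp_apply]
    field_simp

lemma exists_pos_measure_eventually [IsProbabilityMeasure μ] {Ψ : ℕ → X → ℝ}
    (hΨ : ∀ n, Measurable (Ψ n)) {G : X → ℝ} (hG : Integrable G μ)
    (hlim : ∀ᵐ x ∂μ, Tendsto (fun n : ℕ => Ψ n x / n) atTop (𝓝 (G x))) {H : ℝ}
    (hH : H < ∫ x, G x ∂μ) :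
    ∃ N : ℕ, 1 ≤ N ∧ ∃ E, MeasurableSet E ∧ 0 < μ E ∧ ∀ x ∈ E, ∀ n ≥ N, n * H ≤ Ψ n x := by
  set E : ℕ → Set X := fun N => ⋂ n, ⋂ (_ : N + 1 ≤ n), {x | n * H ≤ Ψ n x} with hE
  have hEm : ∀ N, MeasurableSet (E N) := fun N => MeasurableSet.iInter fun n =>
    MeasurableSet.iInter fun _ => measurableSet_le measurable_const (hΨ n)
  by_contra hcon
  have h0 : ∀ N, μ (E N) = 0 := fun N => by
    by_contra h
    exact hcon ⟨N + 1, by omega, E N, hEm N, pos_iff_ne_zero.2 h, fun x hx n hn =>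
      mem_iInter₂.1 hx n hn⟩
  have hU : ∀ᵐ x ∂μ, x ∉ ⋃ N, E N := measure_eq_zero_iff_ae_notMem.1 (measure_iUnion_null h0)
  have hle : ∀ᵐ x ∂μ, G x ≤ H := by
    filter_upwards [hU, hlim] with x hx hl
    by_contra hGx
    push Not at hGx
    obtain ⟨N, hN⟩ := eventually_atTop.1 (hl.eventually (lt_mem_nhds hGx))
    refine hx (mem_iUnion.2 ⟨N, mem_iInter₂.2 fun n hn => ?_⟩)
    have hn' : (0 : ℝ) < n := by exact_mod_cast (show 0 < n by omega)
    have := (lt_div_iff₀ hn').1 (hN n (by omega))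
    rw [mem_ofPred_eq, mul_comm]
    exact this.le
  have := integral_mono_ae hG (integrable_const H) hle
  simp at this
  linarith

lemma measurable_levelSum (hT : Measurable T) (a : Fin k → ℝ) {F : Fin k → X → ℝ}
    (hF : ∀ i, Measurable (F i)) (n : ℕ) : Measurable (levelSum T a F n) :=
  Finset.measurable_sum _ fun i _ => (measurable_birk hT (hF i) _).sub (measurable_birk hT (hF i) _)

lemma le_PLoc_of_coding [NeZero k] [IsProbabilityMeasure μ] (hT : MeasurePreserving T μ μ)
    {a : Fin k → ℝ} (ha1 : 0 < a 0) (ha : ∀ i, 0 ≤ a i) {𝒱 : Fin k → Set (Set X)}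
    {F : Fin k → X → ℝ} (hFm : ∀ i, Measurable (F i)) (hFb : ∀ i, ∃ C, ∀ x, |F i x| ≤ C)
    {f : X → ℝ} (hf : Measurable f) {Cf : ℝ} (hfb : ∀ x, |f x| ≤ Cf) {R : ℝ}
    (hcode : ∀ n : ℕ, 1 ≤ n → ∀ A, MeasurableSet A → (∃ B ∈ jointFiber T a 𝒱 n, A ⊆ B) →
        ∫⁻ x in A, ENNReal.ofReal (Real.exp (levelSum T a F n x)) ∂μ ≤
          ENNReal.ofReal (Real.exp (R * n)))
    {Z : Set X} (hZ : ∀ᵐ x ∂μ, x ∈ Z) :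
    (((∑ i, a i * ∫ x, F i x ∂μ) + ∫ x, f x ∂μ - R : ℝ) : EReal) ≤ PLoc T a 𝒱 Z f := by
  choose C hC using hFb
  choose g hgm hgb hgi hgl using fun i => birkhoff_bounded hT (hFm i) (hC i)
  obtain ⟨gf, hgfm, hgfb, hgfi, hgfl⟩ := birkhoff_bounded hT hf hfb
  set H := (∑ i, a i * ∫ x, F i x ∂μ) + ∫ x, f x ∂μ with hH
  refine le_sInf ?_
  rintro _ ⟨s, hs, rfl⟩
  refine EReal.coe_le_coe_iff.2 (le_of_forall_pos_sub_le fun η hη => ?_)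
  by_contra hlt
  push Not at hlt
  set Ψ : ℕ → X → ℝ := fun n x =>
    levelSum T a F n x + (1 / a 0) * birk T f ⌈a 0 * (n : ℝ)⌉₊ x with hΨ
  have hgint : ∀ i, Integrable (g i) μ := fun i => integrable_of_abs_le (hgm i) (hgb i)
  have hgfint : Integrable gf μ := integrable_of_abs_le hgfm hgfb
  have hGint : Integrable (fun x => (∑ i, a i * g i x) + gf x) μ :=
    (integrable_finsetSum _ fun i _ => (hgint i).const_mul _).add hgfint
  have hGH : ∫ x, ((∑ i, a i * g i x) + gf x) ∂μ = H := by
    rw [integral_add (integrable_finsetSum _ fun i _ => (hgint i).const_mul _) hgfint,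
      integral_finsetSum _ fun i _ => (hgint i).const_mul _, hgfi, hH]
    simp only [integral_const_mul, hgi]
  have hlim : ∀ᵐ x ∂μ, Tendsto (fun n : ℕ => Ψ n x / n) atTop
      (𝓝 ((∑ i, a i * g i x) + gf x)) := by
    filter_upwards [ae_all_iff.2 hgl, hgfl] with x hx hxf
    have h1 : Tendsto (fun n : ℕ => ∑ i, (birk T (F i) ⌈cw a i * (n : ℝ)⌉₊ x / n
        - birk T (F i) ⌈cwl a i * (n : ℝ)⌉₊ x / n)) atTop
        (𝓝 (∑ i, (cw a i * g i x - cwl a i * g i x))) :=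
      tendsto_finsetSum _ fun i _ => (tendsto_birk_ceil (cw_nonneg ha i) (hx i)).sub
        (tendsto_birk_ceil (cwl_nonneg ha i) (hx i))
    have h2 := (tendsto_birk_ceil ha1.le hxf).const_mul (1 / a 0)
    have h3 : (∑ i, a i * g i x) + gf x
        = (∑ i, (cw a i * g i x - cwl a i * g i x)) + (1 / a 0) * (a 0 * gf x) := by
      congr 1
      · refine Finset.sum_congr rfl fun i _ => ?_
        rw [cw_eq]; ring
      · field_simp
    rw [h3]
    refine (h1.add h2).congr fun n => ?_
    simp only [hΨ, levelSum, add_div, Finset.sum_div, sub_div]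
    ring
  obtain ⟨N, hN, E, hE, hE0, hEN⟩ := exists_pos_measure_eventually (H := H - η) (Ψ := Ψ)
    (fun n => (measurable_levelSum hT.measurable a hFm n).add
      ((measurable_birk hT.measurable hf _).const_mul _)) hGint hlim (by linarith)
  have hlamN : lamLocN T a 𝒱 f s N Z = 0 :=
    le_antisymm ((le_iSup (fun N => lamLocN T a 𝒱 f s N Z) N).trans hs.le) bot_le
  refine hE0.not_ge ?_
  rw [← hlamN]
  refine le_iInf fun D => le_iInf fun hD => le_iInf fun hDA => le_iInf fun hDZ => ?_
  have := hD.to_subtype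
  have hpt : ∀ p ∈ D, μ (E ∩ p.2) ≤ pterm T f (a 0) s p.1 p.2 := by
    rintro ⟨n, A⟩ hp
    obtain ⟨hn, hA, hAB⟩ := hDA _ hp
    simp only at hn hA hAB ⊢
    set σ := sSup (birk T f ⌈a 0 * (n : ℝ)⌉₊ '' A) with hσ
    have hbdd : BddAbove (birk T f ⌈a 0 * (n : ℝ)⌉₊ '' A) := by
      refine ⟨⌈a 0 * (n : ℝ)⌉₊ * Cf, ?_⟩
      rintro _ ⟨x, -, rfl⟩
      exact (le_abs_self _).trans (abs_birk_le hfb _ x)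
    have hlow : ∀ x ∈ E ∩ A, n * (H - η) - (1 / a 0) * σ ≤ levelSum T a F n x := fun x hx => by
      have h1 := hEN x hx.1 n hn
      have h2 : birk T f ⌈a 0 * (n : ℝ)⌉₊ x ≤ σ := le_csSup hbdd ⟨x, hx.2, rfl⟩
      have h3 := mul_le_mul_of_nonneg_left h2 (one_div_pos.2 ha1).le
      simp only [hΨ] at h1
      linarith
    have hEA := hE.inter hA
    obtain ⟨B, hB, hAB⟩ := hAB
    have h1 := hcode n (hN.trans hn) _ hEA ⟨B, hB, inter_subset_right.trans hAB⟩
    have h2 : ENNReal.ofReal (Real.exp (n * (H - η) - (1 / a 0) * σ)) * μ (E ∩ A) ≤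
        ENNReal.ofReal (Real.exp (R * n)) := by
      refine le_trans ?_ h1
      rw [← setLIntegral_const]
      exact setLIntegral_mono' hEA fun x hx =>
        ENNReal.ofReal_le_ofReal (Real.exp_le_exp.2 (hlow x hx))
    calc μ (E ∩ A) = ENNReal.ofReal (Real.exp (-(n * (H - η) - (1 / a 0) * σ))) *
          (ENNReal.ofReal (Real.exp (n * (H - η) - (1 / a 0) * σ)) * μ (E ∩ A)) := by
          rw [← mul_assoc, ← ENNReal.ofReal_mul (Real.exp_pos _).le, ← Real.exp_add]
          simp
      _ ≤ ENNReal.ofReal (Real.exp (-(n * (H - η) - (1 / a 0) * σ))) *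
          ENNReal.ofReal (Real.exp (R * n)) := by gcongr
      _ = ENNReal.ofReal (Real.exp (-(n * (H - η) - (1 / a 0) * σ) + R * n)) := by
          rw [← ENNReal.ofReal_mul (Real.exp_pos _).le, ← Real.exp_add]
      _ ≤ _ := by
          refine ENNReal.ofReal_le_ofReal (Real.exp_le_exp.2 ?_)
          have := mul_le_mul_of_nonneg_right hlt.le (Nat.cast_nonneg (α := ℝ) n)
          nlinarith
  calc μ E = μ (E ∩ Z) := (measure_congr (by
        filter_upwards [hZ] with x hx
        exact propext ⟨fun h => h.1, fun h => ⟨h, hx⟩⟩)).symm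
    _ ≤ μ (⋃ p : D, E ∩ p.1.2) := by
        refine measure_mono fun x hx => ?_
        obtain ⟨p, hp, hxp⟩ := mem_iUnion₂.1 (hDZ hx.2)
        exact mem_iUnion.2 ⟨⟨p, hp⟩, hx.1, hxp⟩
    _ ≤ ∑' p : D, μ (E ∩ p.1.2) := measure_iUnion_le _
    _ ≤ ∑' p : D, pterm T f (a 0) s p.1.1 p.1.2 := ENNReal.tsum_le_tsum fun p => hpt p p.2

/-- A lower bound for the local weighted pressure in terms of the entropies of symbol maps which
the covers determine up to the ambiguous symbol `0`. -/
lemma le_PLoc_of_symbols [NeZero k] [IsProbabilityMeasure μ] (hT : Measurable T)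
    (hTμ : μ.map T = μ)
    {m : Fin k → ℕ} {ξ : ∀ j, X → Fin (m j + 1)} (hξ : ∀ j, Measurable (ξ j))
    {a : Fin k → ℝ} (ha1 : 0 < a 0) (ha : ∀ i, 0 ≤ a i) {𝒱 : Fin k → Set (Set X)}
    (h𝒱 : ∀ j, ∀ V ∈ 𝒱 j, ∃ v, ∀ x ∈ V, ξ j x = 0 ∨ ξ j x = v)
    {δ t : ℝ} (hδ : ∀ j, μ.real (ξ j ⁻¹' {0}) ≤ δ) (ht : 0 < t) (ht1 : t ≤ 1)
    {f : X → ℝ} (hf : Measurable f) {Cf : ℝ} (hfb : ∀ x, |f x| ≤ Cf)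
    {Z : Set X} (hZ : ∀ᵐ x ∂μ, x ∈ Z) {b : ℝ}
    (hb : b < (∑ i, a i * (futEnt μ hT (measurable_jointSym hξ i) - k * δ * Real.log (1 / t)))
      + ∫ x, f x ∂μ - k * ((∑ i, a i) + 1) * Real.log (1 + t)) :
    (b : EReal) ≤ PLoc T a 𝒱 Z f := by
  set s := ∑ i, a i with hs
  have hs0 : 0 ≤ s := Finset.sum_nonneg fun i _ => ha i
  set B := (∑ i, a i * (futEnt μ hT (measurable_jointSym hξ i) - k * δ * Real.log (1 / t)))
      + ∫ x, f x ∂μ - k * (s + 1) * Real.log (1 + t) with hB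
  obtain ⟨F, hFm, hFb, hFi, hcode⟩ := exists_coding hT hTμ hξ ha h𝒱 hδ ht ht1
    (η := (B - b) / (s + 1)) (div_pos (by linarith) (by linarith))
  refine le_trans (EReal.coe_le_coe_iff.2 ?_)
    (le_PLoc_of_coding ⟨hT, hTμ⟩ ha1 ha hFm hFb hf hfb hcode hZ)
  have h1 : ∑ i, a i * (futEnt μ hT (measurable_jointSym hξ i) - k * δ * Real.log (1 / t)
      - (B - b) / (s + 1)) ≤ ∑ i, a i * ∫ x, F i x ∂μ :=
    Finset.sum_le_sum fun i _ => mul_le_mul_of_nonneg_left (hFi i) (ha i)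
  simp only [mul_sub (a _) (_ - _) (_ / _)] at h1
  rw [Finset.sum_sub_distrib, ← Finset.sum_mul, ← hs] at h1
  have h2 : s * ((B - b) / (s + 1)) ≤ B - b := by
    rw [mul_div_assoc', div_le_iff₀ (by linarith)]
    nlinarith
  linarith

end Pressure

lemma ae_mem_msupp {X : Type*} [TopologicalSpace X] [SecondCountableTopology X]
    [MeasurableSpace X] (μ : Measure X) : ∀ᵐ x ∂μ, x ∈ msupp μ := by
  refine measure_null_of_locally_null _ fun x hx => ?_
  have hx' : ¬ ∀ U : Set X, IsOpen U → x ∈ U → 0 < μ U := hx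
  push Not at hx'
  obtain ⟨U, hU, hxU, h0⟩ := hx'
  exact ⟨U, mem_nhdsWithin_of_mem_nhds (hU.mem_nhds hxU), le_antisymm h0 bot_le⟩

/-- A finite partition is approximated by an open cover with one more element: off the set where
the coding map `κ` takes the ambiguous value `0`, the elements of the cover determine the atom. -/
lemma exists_cover_of_isPart {Y : Type*} [MetricSpace Y] [MeasurableSpace Y] [BorelSpace Y]
    (ν : Measure Y) [IsProbabilityMeasure ν] {m : ℕ} {α : Fin m → Set Y} (hα : IsPart α)
    {δ : ℝ} (hδ : 0 < δ) :
    ∃ (U : Fin (m + 1) → Set Y) (κ : Y → Fin (m + 1)) (ζ : Y → Fin m)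
      (φ : Fin m → Fin (m + 1)) (ψ : Fin (m + 1) → Fin m),
      (∀ v, IsOpen (U v)) ∧ Measurable κ ∧ Measurable ζ ∧ α = fib ζ ∧ (∀ x, x ∈ U (κ x)) ∧
      (∀ v, ∀ x ∈ U v, κ x = 0 ∨ κ x = v) ∧ (∀ x, κ x ≠ 0 → κ x = φ (ζ x)) ∧
      (∀ x, κ x ≠ 0 → ζ x = ψ (κ x)) ∧ ν.real (κ ⁻¹' {0}) ≤ δ := by
  obtain ⟨ζ, hζ, rfl⟩ := hα.exists_fib
  have hne : Nonempty Y := nonempty_of_isProbabilityMeasure ν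
  have hnm : Nonempty (Fin m) := hne.map ζ
  have hK : ∀ l, ∃ K, K ⊆ fib ζ l ∧ IsClosed K ∧ ν (fib ζ l \ K) < ENNReal.ofReal (δ / m) := by
    intro l
    have hm : (0 : ℝ) < m := by exact_mod_cast l.pos
    exact (hα.1 l).exists_isClosed_sdiff_lt (measure_ne_top _ _)
      (by simpa using div_pos hδ hm)
  choose K hKs hKc hKν using hK
  have hKζ : ∀ {l x}, x ∈ K l → ζ x = l := fun h => hKs _ h
  have hKm : MeasurableSet {x | x ∈ K (ζ x)} := by
    have : {x | x ∈ K (ζ x)} = ⋃ l, K l := by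
      ext x
      exact ⟨fun h => mem_iUnion.2 ⟨_, h⟩, fun h => by
        obtain ⟨l, hl⟩ := mem_iUnion.1 h
        rw [← hKζ hl] at hl
        exact hl⟩
    rw [this]
    exact MeasurableSet.iUnion fun l => (hKc l).measurableSet
  classical
  set κ : Y → Fin (m + 1) := fun x => if x ∈ K (ζ x) then (ζ x).succ else 0 with hκ
  have hκ1 : ∀ {x}, x ∈ K (ζ x) → κ x = (ζ x).succ := fun h => if_pos h
  have hκ0 : ∀ {x}, x ∉ K (ζ x) → κ x = 0 := fun h => if_neg h
  have hκn : ∀ {x}, κ x ≠ 0 → x ∈ K (ζ x) := fun h => by_contra fun h' => h (hκ0 h')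
  refine ⟨Fin.cons (⋃ l, K l)ᶜ fun l => (⋃ l' ∈ {l' | l' ≠ l}, K l')ᶜ, κ, ζ, Fin.succ,
    fun v => Fin.cases (Classical.arbitrary _) id v, ?_, ?_, hζ, rfl, ?_, ?_, ?_, ?_, ?_⟩
  · intro v
    refine Fin.cases ?_ (fun l => ?_) v
    · exact (isClosed_iUnion_of_finite hKc).isOpen_compl
    · exact ((toFinite _).isClosed_biUnion fun l' _ => hKc l').isOpen_compl
  · exact Measurable.ite hKm ((measurable_of_finite Fin.succ).comp hζ) measurable_const
  · intro x
    by_cases h : x ∈ K (ζ x)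
    · rw [hκ1 h, Fin.cons_succ]
      intro hx
      obtain ⟨l, hl, hxl⟩ := mem_iUnion₂.1 hx
      exact hl (hKζ hxl).symm
    · rw [hκ0 h, Fin.cons_zero]
      intro hx
      obtain ⟨l, hxl⟩ := mem_iUnion.1 hx
      exact h (by rw [hKζ hxl]; exact hxl)
  · intro v
    refine Fin.cases (fun x hx => Or.inl (hκ0 fun h => hx (mem_iUnion.2 ⟨_, h⟩)))
      (fun l x hx => ?_) v
    by_cases h : x ∈ K (ζ x)
    · refine Or.inr ?_
      rw [hκ1 h]
      by_contra hne
      exact hx (mem_iUnion₂.2 ⟨ζ x, fun he => hne (by rw [he]), h⟩)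
    · exact Or.inl (hκ0 h)
  · exact fun x hx => hκ1 (hκn hx)
  · intro x hx
    rw [hκ1 (hκn hx)]
    rfl
  · have hsub : κ ⁻¹' {0} ⊆ ⋃ l, (fib ζ l \ K l) := by
      intro x hx
      refine mem_iUnion.2 ⟨ζ x, rfl, fun h => ?_⟩
      have : κ x = 0 := hx
      rw [hκ1 h] at this
      exact Fin.succ_ne_zero _ this
    have hm : (0 : ℝ) < m := by exact_mod_cast (Classical.arbitrary (Fin m)).pos
    refine ENNReal.toReal_le_of_le_ofReal hδ.le ?_
    calc ν (κ ⁻¹' {0}) ≤ ∑ l, ν (fib ζ l \ K l) :=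
          (measure_mono hsub).trans (measure_iUnion_fintype_le _ _)
      _ ≤ ∑ l : Fin m, ENNReal.ofReal (δ / m) := Finset.sum_le_sum fun l _ => (hKν l).le
      _ = ENNReal.ofReal δ := by
          rw [Finset.sum_const, Finset.card_univ, Fintype.card_fin, nsmul_eq_mul,
            ← ENNReal.ofReal_natCast, ← ENNReal.ofReal_mul hm.le, mul_div_cancel₀ _ hm.ne']

/-- The entropy of a cover is close to that of a partition, if off a small set the elements of the
cover determine the atom. -/
lemma hCovPlus_near {X A B : Type*} [MeasurableSpace X] [MeasurableSpace A] [MeasurableSpace B]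
    [Fintype A] [Fintype B] [MeasurableSingletonClass A] [MeasurableSingletonClass B]
    {μ : Measure X} [IsProbabilityMeasure μ] {T : X → X} (hT : Measurable T) (hTμ : μ.map T = μ)
    {κ : X → A} (hκ : Measurable κ) {ζ : X → B} (hζ : Measurable ζ) {D : Set X}
    (hD : MeasurableSet D) {φ : B → A} {ψ : A → B} (hφ : ∀ x, x ∉ D → κ x = φ (ζ x))
    (hψ : ∀ x, x ∉ D → ζ x = ψ (κ x)) {𝒰 : Set (Set X)}
    (h𝒰 : ∀ U ∈ 𝒰, ∃ c, ∀ x ∈ U, x ∉ D → κ x = c) (hκ𝒰 : ∀ c, ∃ U ∈ 𝒰, κ ⁻¹' {c} ⊆ U)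
    {t : ℝ} (ht : 0 < t) (ht1 : t ≤ 1) {e : ℝ}
    (hA : Real.log (1 + Fintype.card A * t) + μ.real D * Real.log (1 / t) ≤ e)
    (hB : Real.log (1 + Fintype.card B * t) + μ.real D * Real.log (1 / t) ≤ e) :
    ∃ r : ℝ, hCovPlus μ T 𝒰 = r ∧ r ≤ futEnt μ hT hζ + e ∧ futEnt μ hT hζ ≤ r + e := by
  have hup : hCovPlus μ T 𝒰 ≤ ((futEnt μ hT hζ + e : ℝ) : EReal) := by
    set E := Fintype.equivFin A with hE
    have hEκ : Measurable (E ∘ κ) := (measurable_of_finite E).comp hκ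
    have href : ∀ i, ∃ U ∈ 𝒰, fib (E ∘ κ) i ⊆ U := fun i => by
      obtain ⟨U, hU, hsub⟩ := hκ𝒰 (E.symm i)
      refine ⟨U, hU, fun x hx => hsub ?_⟩
      have : E (κ x) = i := hx
      rw [mem_preimage, mem_singleton_iff, ← this, E.symm_apply_apply]
    refine (iInf_le _ ⟨Fintype.card A, fib (E ∘ κ), isPart_fib hEκ, href⟩).trans ?_
    · rw [hPart_fib hT hEκ hTμ, EReal.coe_le_coe_iff]
      refine (futEnt_le_add hT hEκ hTμ hζ (E ∘ φ) hD (fun x hx => congrArg E (hφ x hx)) ht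
        ht1).trans ?_
      rw [Fintype.card_fin]
      linarith
  have hlow : ((futEnt μ hT hζ - e : ℝ) : EReal) ≤ hCovPlus μ T 𝒰 := by
    refine le_iInf ?_
    rintro ⟨M, β, hβ, hβU⟩
    obtain ⟨θ, hθ, rfl⟩ := hβ.exists_fib
    have hc : ∀ i, ∃ c, ∀ x ∈ fib θ i, x ∉ D → κ x = c := fun i => by
      obtain ⟨U, hU, hsub⟩ := hβU i
      obtain ⟨c, hc⟩ := h𝒰 U hU
      exact ⟨c, fun x hx => hc x (hsub hx)⟩
    choose c hc using hc
    simp only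
    rw [hPart_fib hT hθ hTμ, EReal.coe_le_coe_iff]
    have := futEnt_le_add hT hζ hTμ hθ (ψ ∘ c) hD
      (fun x hx => (hψ x hx).trans (congrArg ψ (hc (θ x) x rfl hx))) ht ht1
    linarith
  have hne_top : hCovPlus μ T 𝒰 ≠ ⊤ := (hup.trans_lt (EReal.coe_lt_top _)).ne
  have hne_bot : hCovPlus μ T 𝒰 ≠ ⊥ := ((EReal.bot_lt_coe _).trans_le hlow).ne'
  refine ⟨(hCovPlus μ T 𝒰).toReal, (EReal.coe_toReal hne_top hne_bot).symm, ?_, ?_⟩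
  · rw [← EReal.coe_le_coe_iff, EReal.coe_toReal hne_top hne_bot]
    exact hup
  · rw [← sub_le_iff_le_add, ← EReal.coe_le_coe_iff, EReal.coe_toReal hne_top hne_bot]
    exact hlow

lemma partJoinFrom_fib {X : Type*} {Y S : Fin k → Type*} (τ : ∀ j, X → Y j)
    (ζ : ∀ j, Y j → S j) (i : Fin k) :
    partJoinFrom (fun j s => τ j ⁻¹' fib (ζ j) s) i = fib (jointSym (fun j => ζ j ∘ τ j) i) := by
  funext c
  ext x
  simp [partJoinFrom, fib, jointSym, funext_iff]

lemma exists_small_parameters {η : ℝ} (hη : 0 < η) (N k : ℕ) :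
    ∃ t δ : ℝ, 0 < t ∧ t ≤ 1 ∧ 0 < δ ∧ Real.log (1 + t) ≤ η ∧
      (∀ n ≤ N, Real.log (1 + n * t) ≤ η) ∧ (k + 1) * δ * Real.log (1 / t) ≤ η := by
  set t := min (1 / 2) (η / (N + 1)) with ht
  have hN : (0 : ℝ) < N + 1 := by positivity
  have ht0 : 0 < t := lt_min (by norm_num) (div_pos hη hN)
  have ht2 : t ≤ 1 / 2 := min_le_left _ _
  have htN : (N + 1) * t ≤ η := by
    have := mul_le_mul_of_nonneg_left (min_le_right (1 / 2 : ℝ) (η / (N + 1))) hN.le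
    rwa [mul_div_cancel₀ _ hN.ne'] at this
  have hlog : 0 < Real.log (1 / t) :=
    Real.log_pos (by rw [lt_div_iff₀ ht0]; linarith)
  have hn : ∀ n : ℝ, 0 ≤ n → n ≤ N + 1 → Real.log (1 + n * t) ≤ η := fun n hn0 hnN => by
    have h1 := Real.log_le_sub_one_of_pos (show 0 < 1 + n * t by positivity)
    have h2 := mul_le_mul_of_nonneg_right hnN ht0.le
    linarith
  refine ⟨t, η / ((k + 1) * Real.log (1 / t)), ht0, by linarith, by positivity, ?_, ?_, ?_⟩
  · simpa using hn 1 zero_le_one (by linarith [(Nat.cast_nonneg N : (0 : ℝ) ≤ N)])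
  · intro n hnN
    have : (n : ℝ) ≤ N := by exact_mod_cast hnN
    exact hn n (Nat.cast_nonneg n) (by linarith)
  · refine le_of_eq ?_
    field_simp

lemma ereal_coe_sum {ι : Type*} (s : Finset ι) (g : ι → ℝ) :
    ((∑ i ∈ s, g i : ℝ) : EReal) = ∑ i ∈ s, (g i : EReal) := by
  classical
  induction s using Finset.induction_on with
  | empty => simp
  | insert a s ha ih => rw [Finset.sum_insert ha, Finset.sum_insert ha, EReal.coe_add, ih]

/-- (local lower bound with entropy-approximating covers) Given finite Borel
partitions `α_i` of `X_i`, `μ ∈ M(X_1,T_1)` and `ε > 0`, there exist open covers `𝒰_i` of `X_i`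
with `|𝒰_i| = |α_i| + 1` realizing the local lower bound
`P^𝐚(T₁, supp μ, {𝒰_i}, f) ≥ ∑_i a_i h_μ(T₁, ⋁_{j=i}^k τ_{j-1}^{-1}α_j) + ∫ f dμ − ε`
and, in addition, `|h⁺_{τ_{i-1}μ}(T_i, 𝒰_i) − h_{τ_{i-1}μ}(T_i, α_i)| < ε` for each `i`, and
`|∑_i a_i h⁺_μ(T₁, ⋁_{j=i}^k τ_{j-1}^{-1}𝒰_j) − ∑_i a_i h_μ(T₁, ⋁_{j=i}^k τ_{j-1}^{-1}α_j)| < ε`. -/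
theorem local_lower_bound_with_plus_entropy
    {k : ℕ} [NeZero k]
    (X : Fin k → Type) [∀ i, MetricSpace (X i)] [∀ i, CompactSpace (X i)]
    [∀ i, MeasurableSpace (X i)] [∀ i, BorelSpace (X i)]
    (T : ∀ i, X i → X i) (hT : ∀ i, Continuous (T i))
    (τ : ∀ i, X 0 → X i) (hτ0 : τ 0 = id)
    (hτc : ∀ i, Continuous (τ i)) (hτs : ∀ i, Function.Surjective (τ i))
    (hτe : ∀ i, τ i ∘ T 0 = T i ∘ τ i)
    (hchain : ∀ i j : Fin k, i ≤ j → ∃ p : X i → X j,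
        Continuous p ∧ p ∘ T i = T j ∘ p ∧ p ∘ τ i = τ j)
    (a : Fin k → ℝ) (ha1 : 0 < a 0) (ha : ∀ i, 0 ≤ a i)
    (m : Fin k → ℕ) (α : ∀ i, Fin (m i) → Set (X i)) (hα : ∀ i, IsPart (α i))
    (μ : Measure (X 0)) [IsProbabilityMeasure μ] (hμ : μ.map (T 0) = μ)
    (f : X 0 → ℝ) (hf : Continuous f) (ε : ℝ) (hε : 0 < ε) :
    ∃ U : ∀ i, Fin (m i + 1) → Set (X i),
      (∀ i l, IsOpen (U i l)) ∧ (∀ i, (⋃ l, U i l) = Set.univ) ∧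
      ((∑ i : Fin k, ((a i : ℝ) : EReal) *
            hPart μ (T 0) (partJoinFrom (fun j t => τ j ⁻¹' α j t) i))
          + ((∫ x, f x ∂μ : ℝ) : EReal) - ((ε : ℝ) : EReal)
        ≤ PLoc (T 0) a (fun i => pullCov (τ i) (Set.range (U i))) (msupp μ) f) ∧
      (∀ i, hCovPlus (μ.map (τ i)) (T i) (Set.range (U i))
              < hPart (μ.map (τ i)) (T i) (α i) + ((ε : ℝ) : EReal)
          ∧ hPart (μ.map (τ i)) (T i) (α i)
              < hCovPlus (μ.map (τ i)) (T i) (Set.range (U i)) + ((ε : ℝ) : EReal)) ∧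
      ((∑ i : Fin k, ((a i : ℝ) : EReal) *
            hCovPlus μ (T 0) (joinFrom (fun j => pullCov (τ j) (Set.range (U j))) i))
          < (∑ i : Fin k, ((a i : ℝ) : EReal) *
              hPart μ (T 0) (partJoinFrom (fun j t => τ j ⁻¹' α j t) i)) + ((ε : ℝ) : EReal)
        ∧ (∑ i : Fin k, ((a i : ℝ) : EReal) *
              hPart μ (T 0) (partJoinFrom (fun j t => τ j ⁻¹' α j t) i))
            < (∑ i : Fin k, ((a i : ℝ) : EReal) *
                hCovPlus μ (T 0) (joinFrom (fun j => pullCov (τ j) (Set.range (U j))) i))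
              + ((ε : ℝ) : EReal)) := by
  have hTm : ∀ i, Measurable (T i) := fun i => (hT i).measurable
  have hτm : ∀ i, Measurable (τ i) := fun i => (hτc i).measurable
  have hνp : ∀ i, IsProbabilityMeasure (μ.map (τ i)) := fun i =>
    Measure.isProbabilityMeasure_map (hτm i).aemeasurable
  have hνT : ∀ i, (μ.map (τ i)).map (T i) = μ.map (τ i) := fun i => by
    rw [Measure.map_map (hTm i) (hτm i), ← hτe i, ← Measure.map_map (hτm i) (hTm 0), hμ]
  set s := ∑ i, a i with hs
  have hs0 : 0 ≤ s := Finset.sum_nonneg fun i _ => ha i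
  set η := ε / ((s + 1) * (k + 4)) with hη
  have hη0 : 0 < η := by positivity
  have hηε : (s + 1) * (k + 4) * η = ε := by rw [hη]; field_simp
  have hk0 : (0 : ℝ) ≤ k := Nat.cast_nonneg k
  obtain ⟨t, δ, ht, ht1, hδ, hlog, hcard, hδt⟩ := exists_small_parameters hη0
    (∑ i : Fin k, (Fintype.card (∀ j : {j : Fin k // i ≤ j}, Fin (m j + 1)) +
      Fintype.card (∀ j : {j : Fin k // i ≤ j}, Fin (m j)) + (m i + 1))) k
  have hcard' : ∀ (i : Fin k) (n : ℕ), n ≤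
      Fintype.card (∀ j : {j : Fin k // i ≤ j}, Fin (m j + 1)) +
      Fintype.card (∀ j : {j : Fin k // i ≤ j}, Fin (m j)) + (m i + 1) →
      Real.log (1 + n * t) ≤ η := fun i n hn => hcard n (hn.trans
    (Finset.single_le_sum (f := fun i : Fin k =>
      Fintype.card (∀ j : {j : Fin k // i ≤ j}, Fin (m j + 1)) +
      Fintype.card (∀ j : {j : Fin k // i ≤ j}, Fin (m j)) + (m i + 1))
      (fun _ _ => Nat.zero_le _) (Finset.mem_univ i)))
  have hlt : 0 ≤ Real.log (1 / t) := Real.log_nonneg (by rw [le_div_iff₀ ht]; linarith)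
  choose U κ ζ φ ψ hUo hκm hζm hαζ hκU hUκ hφ hψ hD using fun i =>
    exists_cover_of_isPart (μ.map (τ i)) (hα i) hδ
  set ξ : ∀ j, X 0 → Fin (m j + 1) := fun j => κ j ∘ τ j with hξ
  set ω : ∀ j, X 0 → Fin (m j) := fun j => ζ j ∘ τ j with hω
  have hξm : ∀ j, Measurable (ξ j) := fun j => (hκm j).comp (hτm j)
  have hωm : ∀ j, Measurable (ω j) := fun j => (hζm j).comp (hτm j)
  have hξδ : ∀ j, μ.real (ξ j ⁻¹' {0}) ≤ δ := fun j => by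
    have h1 := hD j
    rwa [map_measureReal_apply (hτm j) (hκm j (measurableSet_singleton 0))] at h1
  set D : Set (X 0) := ⋃ j, ξ j ⁻¹' {0} with hDdef
  have hDm : MeasurableSet D := MeasurableSet.iUnion fun j => hξm j (measurableSet_singleton 0)
  have hDδ : μ.real D ≤ (k + 1) * δ := by
    refine (measureReal_iUnion_fintype_le _).trans ((Finset.sum_le_sum fun j _ => hξδ j).trans ?_)
    rw [Finset.sum_const, Finset.card_univ, Fintype.card_fin, nsmul_eq_mul]
    nlinarith
  have hξD : ∀ {x}, x ∉ D → ∀ j, κ j (τ j x) ≠ 0 := fun hx j h => hx (mem_iUnion.2 ⟨j, h⟩)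
  have herr : ∀ {d : ℝ}, d ≤ (k + 1) * δ → d * Real.log (1 / t) ≤ η := fun hd =>
    (mul_le_mul_of_nonneg_right hd hlt).trans hδt
  set h : Fin k → ℝ := fun i => futEnt μ (hTm 0) (measurable_jointSym hωm i) with hh
  have hpart : ∀ i, hPart μ (T 0) (partJoinFrom (fun j t => τ j ⁻¹' α j t) i) = (h i : EReal) := by
    intro i
    have : (fun j t => τ j ⁻¹' α j t) = fun j t => τ j ⁻¹' fib (ζ j) t := by
      funext j; rw [← hαζ j]
    rw [this, partJoinFrom_fib]
    exact hPart_fib (hTm 0) _ hμ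
  -- the joint symbols of the partitions and of the approximating maps determine each other off `D`
  have hφD : ∀ i x, x ∉ D → jointSym ξ i x =
      (fun (c : ∀ j : {j : Fin k // i ≤ j}, Fin (m j)) (j : {j : Fin k // i ≤ j}) => φ j (c j))
        (jointSym ω i x) := fun i x hx => funext fun j => hφ j (τ j x) (hξD hx j)
  have hψD : ∀ i x, x ∉ D → jointSym ω i x =
      (fun (c : ∀ j : {j : Fin k // i ≤ j}, Fin (m j + 1)) (j : {j : Fin k // i ≤ j}) => ψ j (c j))
        (jointSym ξ i x) := fun i x hx => funext fun j => hψ j (τ j x) (hξD hx j)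
  have heA : ∀ i : Fin k,
      Real.log (1 + Fintype.card (∀ j : {j : Fin k // i ≤ j}, Fin (m j + 1)) * t)
      + μ.real D * Real.log (1 / t) ≤ 2 * η := fun i => by
    linarith [hcard' i _ (by omega : Fintype.card (∀ j : {j : Fin k // i ≤ j}, Fin (m j + 1)) ≤ _),
      herr hDδ]
  have heB : ∀ i : Fin k, Real.log (1 + Fintype.card (∀ j : {j : Fin k // i ≤ j}, Fin (m j)) * t)
      + μ.real D * Real.log (1 / t) ≤ 2 * η := fun i => by
    linarith [hcard' i _ (by omega : Fintype.card (∀ j : {j : Fin k // i ≤ j}, Fin (m j)) ≤ _),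
      herr hDδ]
  have hξω : ∀ i, h i ≤ futEnt μ (hTm 0) (measurable_jointSym hξm i) + 2 * η := fun i =>
    (futEnt_le_add (hTm 0) (measurable_jointSym hωm i) hμ (measurable_jointSym hξm i)
      (fun (c : ∀ j : {j : Fin k // i ≤ j}, Fin (m j + 1)) (j : {j : Fin k // i ≤ j}) => ψ j (c j))
      hDm (hψD i) ht ht1).trans (by linarith [heB i])
  have hjoin : ∀ i, ∃ r : ℝ,
      hCovPlus μ (T 0) (joinFrom (fun j => pullCov (τ j) (Set.range (U j))) i) = r ∧
        r ≤ h i + 2 * η ∧ h i ≤ r + 2 * η := by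
    intro i
    refine hCovPlus_near (hTm 0) hμ (measurable_jointSym hξm i) (measurable_jointSym hωm i) hDm
      (φ := fun (c : ∀ j : {j : Fin k // i ≤ j}, Fin (m j)) (j : {j : Fin k // i ≤ j}) => φ j (c j))
      (ψ := fun (c : ∀ j : {j : Fin k // i ≤ j}, Fin (m j + 1)) (j : {j : Fin k // i ≤ j}) =>
        ψ j (c j))
      (hφD i) (hψD i) ?_ ?_ ht ht1 (heA i) (heB i)
    · rintro _ ⟨V, hV, rfl⟩
      have hV' : ∀ j : {j : Fin k // i ≤ j}, ∃ v, V j = τ j ⁻¹' U j v := fun j => by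
        obtain ⟨_, ⟨v, rfl⟩, hv⟩ := hV j j.2
        exact ⟨v, hv.symm⟩
      choose v hv using hV'
      refine ⟨v, fun x hx hxD => funext fun j => ?_⟩
      have hxj : x ∈ V j := mem_iInter₂.1 hx j (Finset.mem_Ici.2 j.2)
      rw [hv j] at hxj
      exact (hUκ j (v j) _ hxj).resolve_left (hξD hxD j)
    · intro c
      refine ⟨_, ⟨fun j => if hj : i ≤ j then τ j ⁻¹' U j (c ⟨j, hj⟩) else ∅, fun j hj => ?_, rfl⟩,
        fun x hx => mem_iInter₂.2 fun j hj => ?_⟩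
      · beta_reduce
        rw [dif_pos hj]
        exact ⟨_, ⟨_, rfl⟩, rfl⟩
      · have hij := Finset.mem_Ici.1 hj
        beta_reduce
        rw [dif_pos hij]
        have hc : κ j (τ j x) = c ⟨j, hij⟩ := congrFun (show jointSym ξ i x = c from hx) ⟨j, hij⟩
        rw [mem_preimage, ← hc]
        exact hκU j _
  have hone : ∀ i, ∃ r : ℝ, hCovPlus (μ.map (τ i)) (T i) (Set.range (U i)) = r ∧
      r ≤ futEnt (μ.map (τ i)) (hTm i) (hζm i) + 2 * η ∧
      futEnt (μ.map (τ i)) (hTm i) (hζm i) ≤ r + 2 * η := by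
    intro i
    have hd := herr ((hD i).trans (show δ ≤ (k + 1) * δ by nlinarith))
    refine hCovPlus_near (hTm i) (hνT i) (hκm i) (hζm i)
      (hκm i (measurableSet_singleton 0)) (hφ i) (hψ i) ?_ ?_ ht ht1 ?_ ?_
    · rintro _ ⟨v, rfl⟩
      exact ⟨v, fun x hx hx0 => (hUκ i v x hx).resolve_left hx0⟩
    · intro c
      refine ⟨_, ⟨c, rfl⟩, fun x hx => ?_⟩
      rw [← (show κ i x = c from hx)]
      exact hκU i x
    · rw [Fintype.card_fin]
      linarith [hcard' i (m i + 1) (by omega)]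
    · rw [Fintype.card_fin]
      linarith [hcard' i (m i) (by omega)]
  have hsum : ∑ i : Fin k, ((a i : ℝ) : EReal) *
      hPart μ (T 0) (partJoinFrom (fun j t => τ j ⁻¹' α j t) i) =
      ((∑ i, a i * h i : ℝ) : EReal) := by
    simp only [hpart, ereal_coe_sum, EReal.coe_mul]
  have hηk : 0 ≤ k * η := mul_nonneg hk0 hη0.le
  have hηs : 0 ≤ s * η := mul_nonneg hs0 hη0.le
  have hηsk : 0 ≤ s * (k * η) := mul_nonneg hs0 hηk
  refine ⟨U, hUo, fun i => ?_, ?_, fun i => ?_, ?_⟩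
  · exact eq_univ_of_forall fun x => mem_iUnion.2 ⟨_, hκU i x⟩
  · rw [hsum, ← EReal.coe_add, ← EReal.coe_sub]
    obtain ⟨Cf, hCf⟩ := isCompact_univ.exists_bound_of_continuousOn hf.continuousOn
    refine le_PLoc_of_symbols (hTm 0) hμ hξm ha1 ha ?_ hξδ ht ht1 hf.measurable
      (fun x => hCf x (mem_univ x)) (ae_mem_msupp μ) ?_
    · rintro j _ ⟨_, ⟨v, rfl⟩, rfl⟩
      exact ⟨v, fun x hx => hUκ j v _ hx⟩
    · have h1 : ∑ i, a i * (h i - 3 * η) ≤ ∑ i, a i *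
          (futEnt μ (hTm 0) (measurable_jointSym hξm i) - k * δ * Real.log (1 / t)) := by
        refine Finset.sum_le_sum fun i _ => mul_le_mul_of_nonneg_left ?_ (ha i)
        have := herr (show k * δ ≤ (k + 1) * δ by linarith)
        linarith [hξω i]
      have h2 : ∑ i, a i * (h i - 3 * η) = ∑ i, a i * h i - s * (3 * η) := by
        simp only [mul_sub, Finset.sum_sub_distrib, ← Finset.sum_mul, hs]
      have h3 : k * (s + 1) * Real.log (1 + t) ≤ k * (s + 1) * η :=
        mul_le_mul_of_nonneg_left hlog (by positivity)
      nlinarith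
  · obtain ⟨r, hr, hr1, hr2⟩ := hone i
    have hα' : hPart (μ.map (τ i)) (T i) (α i)
        = (futEnt (μ.map (τ i)) (hTm i) (hζm i) : EReal) := by
      rw [hαζ i]
      exact hPart_fib (hTm i) (hζm i) (hνT i)
    rw [hr, hα', ← EReal.coe_add, ← EReal.coe_add, EReal.coe_lt_coe_iff, EReal.coe_lt_coe_iff]
    constructor <;> nlinarith
  · choose r hr hr1 hr2 using hjoin
    have hsumr : ∑ i : Fin k, ((a i : ℝ) : EReal) *
        hCovPlus μ (T 0) (joinFrom (fun j => pullCov (τ j) (Set.range (U j))) i) =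
        ((∑ i, a i * r i : ℝ) : EReal) := by
      simp only [hr, ereal_coe_sum, EReal.coe_mul]
    have h1 : ∑ i, a i * r i ≤ ∑ i, a i * (h i + 2 * η) :=
      Finset.sum_le_sum fun i _ => mul_le_mul_of_nonneg_left (hr1 i) (ha i)
    have h2 : ∑ i, a i * h i ≤ ∑ i, a i * (r i + 2 * η) :=
      Finset.sum_le_sum fun i _ => mul_le_mul_of_nonneg_left (hr2 i) (ha i)
    simp only [mul_add, Finset.sum_add_distrib, ← Finset.sum_mul, ← hs] at h1 h2
    rw [hsum, hsumr, ← EReal.coe_add, ← EReal.coe_add, EReal.coe_lt_coe_iff, EReal.coe_lt_coe_iff]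
    constructor <;> nlinarith

end WTP
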